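/- arXiv:1801.03553 — 4 statements merged into one kernel-verified Lean document; each statement's English description precedes it below -/
import Mathlib

section
/- Let t > 0. Let X be a random vector in ℝ^p with a density, mean 0, finite second moments, and covariance matrix Σ, and let Z be a random vector in ℝ^p, independent of X, with a density, mean 0, finite second moments, and covariance matrix I_p. Let X_t = X + √t·Z. Assume the mutual information I(X; X_t) and the non-Gaussianities D(√t·Z) and D(X_t) are all finite. Then I(X; X_t) = (1/2)·log det(I_p + Σ/t) + D(√t·Z) − D(X_t). -/
open MeasureTheory ProbabilityTheory Filter Topology Matrix

/-- Kullback–Leibler divergence `KL(μ‖ν)`, as an extended real number: it equals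
`∫ log (dμ/dν) dμ` when `μ ≪ ν` and the log-likelihood ratio is `μ`-integrable,
and `⊤` otherwise. -/
noncomputable def klDiv {α : Type*} [MeasurableSpace α] (μ ν : Measure α) : EReal := by
  classical
  exact if μ ≪ ν ∧ Integrable (fun x => Real.log ((μ.rnDeriv ν x).toReal)) μ then
    ((∫ x, Real.log ((μ.rnDeriv ν x).toReal) ∂μ : ℝ) : EReal)
  else ⊤

/-- Mutual information `I(U;V)`: the Kullback–Leibler divergence between the joint
law of `(U, V)` and the product of the marginal laws of `U` and `V`. -/
noncomputable def mutualInfo {Ω α β : Type*} [MeasurableSpace Ω] [MeasurableSpace α]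
    [MeasurableSpace β] (P : Measure Ω) (U : Ω → α) (V : Ω → β) : EReal :=
  klDiv (P.map fun ω => (U ω, V ω)) ((P.map U).prod (P.map V))

/-- The standard Gaussian measure on `ℝ^p = Fin p → ℝ` (i.i.d. `N(0,1)` coordinates). -/
noncomputable def stdGaussian (p : ℕ) : Measure (Fin p → ℝ) :=
  Measure.pi fun _ => gaussianReal 0 1


open scoped ENNReal

lemma klDiv_ne_top_aux {α : Type*} [MeasurableSpace α] {μ ν : Measure α} (h : klDiv μ ν ≠ ⊤) :
    μ ≪ ν ∧ Integrable (fun x => Real.log ((μ.rnDeriv ν x).toReal)) μ ∧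
    klDiv μ ν = ((∫ x, Real.log ((μ.rnDeriv ν x).toReal) ∂μ : ℝ) : EReal) := by
  unfold klDiv at h ⊢
  split_ifs at h ⊢ with h1
  · exact ⟨h1.1, h1.2, rfl⟩
  · exact absurd rfl h

lemma log_rnDeriv_chain {α : Type*} [MeasurableSpace α] {μ ν κ : Measure α}
    [SigmaFinite μ] [SigmaFinite ν] [SigmaFinite κ] (h1 : μ ≪ ν) (h2 : ν ≪ κ) :
    ∀ᵐ x ∂μ, Real.log ((μ.rnDeriv ν x).toReal)
      = Real.log ((μ.rnDeriv κ x).toReal) - Real.log ((ν.rnDeriv κ x).toReal) := by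
  have h3 := h1.trans h2
  filter_upwards [h3.ae_le (Measure.rnDeriv_mul_rnDeriv (κ := κ) h1), Measure.rnDeriv_pos h1,
    h1.ae_le (Measure.rnDeriv_lt_top μ ν), h1.ae_le (Measure.rnDeriv_pos h2),
    h3.ae_le (Measure.rnDeriv_lt_top ν κ)] with x hx a1 a2 a3 a4
  rw [← hx, Pi.mul_apply, ENNReal.toReal_mul, Real.log_mul]
  · ring
  · exact (ENNReal.toReal_pos a1.ne' a2.ne).ne'
  · exact (ENNReal.toReal_pos a3.ne' a4.ne).ne'

lemma stdGaussian_eq_withDensity (p : ℕ) :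
    _root_.stdGaussian p = (volume : Measure (Fin p → ℝ)).withDensity
      (fun x => ENNReal.ofReal (∏ i, gaussianPDFReal 0 1 (x i))) := by
  refine Measure.pi_eq fun s hs => ?_
  have hg : ∀ i, Integrable ((s i).indicator (gaussianPDFReal 0 1)) :=
    fun i => (integrable_gaussianPDFReal 0 1).indicator (hs i)
  rw [withDensity_apply _ (MeasurableSet.univ_pi hs),
    ← lintegral_indicator (MeasurableSet.univ_pi hs)]
  have e1 : ∀ x : Fin p → ℝ, (Set.univ.pi s).indicator
      (fun x => ENNReal.ofReal (∏ i, gaussianPDFReal 0 1 (x i))) x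
      = ENNReal.ofReal (∏ i, (s i).indicator (gaussianPDFReal 0 1) (x i)) := by
    intro x
    by_cases hx : x ∈ Set.univ.pi s
    · rw [Set.indicator_of_mem hx]
      congr 1
      refine Finset.prod_congr rfl fun i _ => ?_
      rw [Set.indicator_of_mem (hx i (Set.mem_univ i))]
    · rw [Set.indicator_of_notMem hx]
      simp only [Set.mem_pi, Set.mem_univ, true_implies, not_forall] at hx
      obtain ⟨i, hi⟩ := hx
      rw [Finset.prod_eq_zero (Finset.mem_univ i) (Set.indicator_of_notMem hi _)]
      simp
  have hnn : ∀ i x, 0 ≤ (s i).indicator (gaussianPDFReal 0 1) x := fun i x =>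
    Set.indicator_nonneg (fun y _ => gaussianPDFReal_nonneg 0 1 y) x
  simp_rw [e1]
  have hI : Integrable (fun x : Fin p → ℝ => ∏ i, (s i).indicator (gaussianPDFReal 0 1) (x i)) volume :=
    Integrable.fintype_prod hg
  rw [← ofReal_integral_eq_lintegral_ofReal hI
    (ae_of_all _ fun x => Finset.prod_nonneg fun i _ => hnn i _),
    integral_fintype_prod_volume_eq_prod (fun i => (s i).indicator (gaussianPDFReal 0 1)),
    ENNReal.ofReal_prod_of_nonneg (fun i _ => integral_nonneg (hnn i))]
  refine Finset.prod_congr rfl fun i _ => ?_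
  rw [gaussianReal_apply_eq_integral _ (by simp), integral_indicator (hs i)]

lemma gauss_map_withDensity {p : ℕ} (A : Matrix (Fin p) (Fin p) ℝ) (hA : A.det ≠ 0) :
    (_root_.stdGaussian p).map (fun w => A.mulVec w) = (volume : Measure (Fin p → ℝ)).withDensity
      (fun x => ENNReal.ofReal (|A.det⁻¹| * ∏ i, gaussianPDFReal 0 1 ((A⁻¹.mulVec x) i))) := by
  have hm : Measurable (fun w : Fin p → ℝ => A.mulVec w) :=
    (Continuous.matrix_mulVec continuous_const continuous_id).measurable
  have hm' : Measurable (fun w : Fin p → ℝ => A⁻¹.mulVec w) :=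
    (Continuous.matrix_mulVec continuous_const continuous_id).measurable
  have hgm : Measurable (fun x : Fin p → ℝ => ENNReal.ofReal (∏ i, gaussianPDFReal 0 1 (x i))) := by
    fun_prop
  have hgm' : Measurable (fun x : Fin p → ℝ =>
      ENNReal.ofReal (∏ i, gaussianPDFReal 0 1 ((A⁻¹.mulVec x) i))) := hgm.comp hm'
  have hmap : (volume : Measure (Fin p → ℝ)).map (fun w => A.mulVec w)
      = ENNReal.ofReal |A.det⁻¹| • volume := by
    rw [← Real.map_matrix_volume_pi_eq_smul_volume_pi hA]
    rfl
  have h1 : (_root_.stdGaussian p).map (fun w => A.mulVec w)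
      = ((volume : Measure (Fin p → ℝ)).map (fun w => A.mulVec w)).withDensity
        (fun x => ENNReal.ofReal (∏ i, gaussianPDFReal 0 1 ((A⁻¹.mulVec x) i))) := by
    ext s hs
    rw [Measure.map_apply hm hs, stdGaussian_eq_withDensity, withDensity_apply _ (hm hs),
      withDensity_apply _ hs, setLIntegral_map hs hgm' hm]
    refine lintegral_congr fun x => ?_
    simp [Matrix.mulVec_mulVec, Matrix.nonsing_inv_mul A (isUnit_iff_ne_zero.mpr hA)]
  rw [h1, hmap, withDensity_smul_measure, ← withDensity_smul _ hgm']
  congr 1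
  ext x
  simp [ENNReal.ofReal_mul]

lemma log_gauss {p : ℕ} (A : Matrix (Fin p) (Fin p) ℝ) (hA : A.det ≠ 0) (x : Fin p → ℝ) :
    Real.log (|A.det⁻¹| * ∏ i, gaussianPDFReal 0 1 ((A⁻¹.mulVec x) i))
    = -Real.log |A.det| - p * Real.log (√(2 * Real.pi)) - (∑ i, (A⁻¹.mulVec x i) ^ 2) / 2 := by
  rw [Real.log_mul (by simpa using hA)
    (Finset.prod_ne_zero_iff.mpr fun i _ => (gaussianPDFReal_pos _ _ _ (by simp)).ne'),
    Real.log_prod (fun i _ => (gaussianPDFReal_pos _ _ _ (by simp)).ne'), abs_inv, Real.log_inv]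
  have : ∀ y : ℝ, Real.log (gaussianPDFReal 0 1 y) = -Real.log (√(2 * Real.pi)) - y ^ 2 / 2 := by
    intro y
    rw [gaussianPDFReal, Real.log_mul (by positivity) (by positivity), Real.log_exp, Real.log_inv]
    simp
    ring
  simp_rw [this]
  rw [Finset.sum_sub_distrib, ← Finset.sum_div]
  simp
  ring

/-- Non-Gaussianity formula. -/
lemma klDiv_gauss {Ω : Type*} [MeasurableSpace Ω] (P : Measure Ω) [IsProbabilityMeasure P]
    {p : ℕ} (A : Matrix (Fin p) (Fin p) ℝ) (hA : A.det ≠ 0)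
    (V : Ω → Fin p → ℝ) (hV : Measurable V)
    (hVsq : ∀ i j, Integrable (fun ω => V ω i * V ω j) P)
    (hVcov : ∀ i j, ∫ ω, V ω i * V ω j ∂P = (A * Aᵀ) i j)
    (hfin : klDiv (P.map V) ((_root_.stdGaussian p).map fun w => A.mulVec w) ≠ ⊤) :
    P.map V ≪ volume ∧
    Integrable (fun ω => Real.log (((P.map V).rnDeriv volume (V ω)).toReal)) P ∧
    klDiv (P.map V) ((_root_.stdGaussian p).map fun w => A.mulVec w) =
      ((∫ ω, Real.log (((P.map V).rnDeriv volume (V ω)).toReal) ∂P + Real.log |A.det|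
        + p * Real.log (√(2 * Real.pi)) + p / 2 : ℝ) : EReal) := by
  obtain ⟨hac, hint, heq⟩ := klDiv_ne_top_aux hfin
  have hprob : IsProbabilityMeasure (P.map V) := Measure.isProbabilityMeasure_map hV.aemeasurable
  have hgp : IsProbabilityMeasure (_root_.stdGaussian p) := by
    unfold _root_.stdGaussian; infer_instance
  have hm : Measurable (fun w : Fin p → ℝ => A.mulVec w) :=
    (Continuous.matrix_mulVec continuous_const continuous_id).measurable
  have hgp2 := Measure.isProbabilityMeasure_map (μ := _root_.stdGaussian p) hm.aemeasurable
  set G := (_root_.stdGaussian p).map fun w => A.mulVec w with hG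
  have hGd := gauss_map_withDensity A hA
  rw [← hG] at hGd
  have hGv : G ≪ volume := by rw [hGd]; exact withDensity_absolutelyContinuous _ _
  have hVv := hac.trans hGv
  have hm' : Measurable (fun w : Fin p → ℝ => A⁻¹.mulVec w) :=
    (Continuous.matrix_mulVec continuous_const continuous_id).measurable
  have hgm : Measurable (fun x : Fin p → ℝ => ENNReal.ofReal (|A.det⁻¹| * ∏ i, gaussianPDFReal 0 1 (x i))) := by
    fun_prop
  have hrn : G.rnDeriv volume =ᵐ[volume] fun x =>
      ENNReal.ofReal (|A.det⁻¹| * ∏ i, gaussianPDFReal 0 1 ((A⁻¹.mulVec x) i)) := by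
    rw [hGd]; exact Measure.rnDeriv_withDensity volume (hgm.comp hm')
  have key : ∀ᵐ x ∂(P.map V), Real.log (((P.map V).rnDeriv G x).toReal)
      = Real.log (((P.map V).rnDeriv volume x).toReal) + Real.log |A.det|
        + p * Real.log (√(2 * Real.pi)) + (∑ i, (A⁻¹.mulVec x i) ^ 2) / 2 := by
    filter_upwards [log_rnDeriv_chain hac hGv, hVv.ae_le hrn] with x h1 h2
    rw [h1, h2]
    rw [ENNReal.toReal_ofReal (mul_nonneg (abs_nonneg _)
      (Finset.prod_nonneg fun i _ => gaussianPDFReal_nonneg _ _ _)), log_gauss A hA]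
    ring
  have key' := ae_of_ae_map hV.aemeasurable key
  have hmeas : Measurable fun x => Real.log (((P.map V).rnDeriv G x).toReal) := by fun_prop
  have hint' : Integrable (fun ω => Real.log (((P.map V).rnDeriv G (V ω)).toReal)) P :=
    (integrable_map_measure hmeas.aestronglyMeasurable hV.aemeasurable).mp hint
  -- the quadratic term
  have hexp : ∀ ω, (∑ i, (A⁻¹.mulVec (V ω) i) ^ 2)
      = ∑ i, ∑ j, ∑ k, (A⁻¹ i j * A⁻¹ i k) * (V ω j * V ω k) := by
    intro ω
    refine Finset.sum_congr rfl fun i _ => ?_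
    rw [sq, Matrix.mulVec, dotProduct, Finset.sum_mul_sum]
    refine Finset.sum_congr rfl fun j _ => Finset.sum_congr rfl fun k _ => ?_
    ring
  have hqi : Integrable (fun ω => ∑ i, (A⁻¹.mulVec (V ω) i) ^ 2) P := by
    simp_rw [hexp]
    exact integrable_finsetSum _ fun i _ => integrable_finsetSum _ fun j _ =>
      integrable_finsetSum _ fun k _ => (hVsq j k).const_mul _
  have hq : ∫ ω, ∑ i, (A⁻¹.mulVec (V ω) i) ^ 2 ∂P = p := by
    simp_rw [hexp]
    rw [integral_finsetSum _ fun i _ => integrable_finsetSum _ fun j _ =>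
      integrable_finsetSum _ fun k _ => (hVsq j k).const_mul _]
    have : ∀ i, ∫ ω, ∑ j, ∑ k, (A⁻¹ i j * A⁻¹ i k) * (V ω j * V ω k) ∂P = 1 := by
      intro i
      rw [integral_finsetSum _ fun j _ =>
        integrable_finsetSum _ fun k _ => (hVsq j k).const_mul _]
      have h2 : ∀ j, ∫ ω, ∑ k, (A⁻¹ i j * A⁻¹ i k) * (V ω j * V ω k) ∂P
          = ∑ k, (A⁻¹ i j * (A * Aᵀ) j k) * A⁻¹ᵀ k i := by
        intro j
        rw [integral_finsetSum _ fun k _ => (hVsq j k).const_mul _]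
        refine Finset.sum_congr rfl fun k _ => ?_
        rw [integral_const_mul, hVcov, Matrix.transpose_apply A⁻¹]
        ring
      simp_rw [h2]
      have h3 : A⁻¹ * (A * Aᵀ) * A⁻¹ᵀ = 1 := by
        rw [← Matrix.mul_assoc, Matrix.nonsing_inv_mul A (isUnit_iff_ne_zero.mpr hA),
          Matrix.one_mul, ← Matrix.transpose_mul, Matrix.nonsing_inv_mul A (isUnit_iff_ne_zero.mpr hA),
          Matrix.transpose_one]
      rw [Finset.sum_comm]
      have h4 := congrFun (congrFun h3 i) i
      rw [Matrix.mul_apply, Matrix.one_apply_eq] at h4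
      rw [← h4]
      refine Finset.sum_congr rfl fun k _ => ?_
      rw [Matrix.mul_apply, Finset.sum_mul]
    simp [this]
  have hci : Integrable (fun ω => Real.log |A.det| + p * Real.log (√(2 * Real.pi))
      + (∑ i, (A⁻¹.mulVec (V ω) i) ^ 2) / 2) P :=
    (integrable_const _).add (hqi.div_const 2)
  have hfi : Integrable (fun ω => Real.log (((P.map V).rnDeriv volume (V ω)).toReal)) P := by
    refine (hint'.sub hci).congr ?_
    filter_upwards [key'] with ω h
    simp only [Pi.sub_apply]
    rw [h]; ring
  refine ⟨hVv, hfi, ?_⟩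
  rw [heq, integral_map hV.aemeasurable hmeas.aestronglyMeasurable]
  congr 1
  have : ∫ ω, Real.log (((P.map V).rnDeriv G (V ω)).toReal) ∂P
      = ∫ ω, (Real.log (((P.map V).rnDeriv volume (V ω)).toReal) +
        (Real.log |A.det| + p * Real.log (√(2 * Real.pi))
      + (∑ i, (A⁻¹.mulVec (V ω) i) ^ 2) / 2)) ∂P := by
    refine integral_congr_ae ?_
    filter_upwards [key'] with ω h
    rw [h]; ring
  rw [this, integral_add hfi hci, integral_add (integrable_const _) (hqi.div_const 2),
    integral_div, hq]
  simp
  ring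

lemma mutualInfo_formula {Ω : Type*} [MeasurableSpace Ω] (P : Measure Ω) [IsProbabilityMeasure P]
    {p : ℕ} (X Y : Ω → Fin p → ℝ) (hX : Measurable X) (hY : Measurable Y)
    (hindep : IndepFun X Y P)
    (hYv : P.map Y ≪ volume) (hWv : P.map (fun ω => X ω + Y ω) ≪ volume)
    (hYi : Integrable (fun ω => Real.log (((P.map Y).rnDeriv volume (Y ω)).toReal)) P)
    (hWi : Integrable (fun ω => Real.log (((P.map (fun ω => X ω + Y ω)).rnDeriv volume
      (X ω + Y ω)).toReal)) P)
    (hfin : mutualInfo P X (fun ω => X ω + Y ω) ≠ ⊤) :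
    mutualInfo P X (fun ω => X ω + Y ω) =
      ((∫ ω, Real.log (((P.map Y).rnDeriv volume (Y ω)).toReal) ∂P
      - ∫ ω, Real.log (((P.map (fun ω => X ω + Y ω)).rnDeriv volume
      (X ω + Y ω)).toReal) ∂P : ℝ) : EReal) := by
  obtain ⟨hac, hint, heq⟩ := klDiv_ne_top_aux hfin
  have hW : Measurable fun ω => X ω + Y ω := hX.add hY
  have i1 : IsProbabilityMeasure (P.map X) := Measure.isProbabilityMeasure_map hX.aemeasurable
  have i2 : IsProbabilityMeasure (P.map Y) := Measure.isProbabilityMeasure_map hY.aemeasurable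
  have i3 : IsProbabilityMeasure (P.map fun ω => X ω + Y ω) :=
    Measure.isProbabilityMeasure_map hW.aemeasurable
  have hXW : Measurable fun ω => (X ω, X ω + Y ω) := hX.prodMk hW
  have hXY : Measurable fun ω => (X ω, Y ω) := hX.prodMk hY
  have i4 : IsProbabilityMeasure (P.map fun ω => (X ω, X ω + Y ω)) :=
    Measure.isProbabilityMeasure_map hXW.aemeasurable
  set μX := P.map X
  set μY := P.map Y
  set μW := P.map fun ω => X ω + Y ω
  set J := P.map fun ω => (X ω, X ω + Y ω) with hJ
  -- product densities
  have hprod : ∀ ν : Measure (Fin p → ℝ), IsProbabilityMeasure ν → ν ≪ volume →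
      (μX.prod ν).rnDeriv (μX.prod volume) =ᵐ[μX.prod volume]
        fun z => ν.rnDeriv volume z.2 := by
    intro ν hν hac
    have : μX.prod ν = (μX.prod volume).withDensity (fun z => ν.rnDeriv volume z.2) := by
      rw [← prod_withDensity_right (Measure.measurable_rnDeriv _ _),
        Measure.withDensity_rnDeriv_eq _ _ hac]
    rw [this]
    exact Measure.rnDeriv_withDensity _ ((Measure.measurable_rnDeriv _ _).comp measurable_snd)
  have hXYprod : P.map (fun ω => (X ω, Y ω)) = μX.prod μY :=
    (indepFun_iff_map_prod_eq_prod_map_map hX.aemeasurable hY.aemeasurable).mp hindep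
  let e := MeasurableEquiv.shearAddRight (Fin p → ℝ)
  have he : ∀ z, e z = (z.1, z.1 + z.2) := fun z => rfl
  have hJe : J = (μX.prod μY).map e := by
    rw [← hXYprod, Measure.map_map e.measurable hXY]; rfl
  have hKe : (μX.prod (volume : Measure (Fin p → ℝ))).map e = μX.prod volume :=
    (measurePreserving_prod_add μX volume).map_eq
  have hJrn := e.measurableEmbedding.rnDeriv_map (μX.prod μY) (μX.prod volume)
  rw [← hJe, hKe] at hJrn
  have hpv : μX.prod μY ≪ μX.prod volume := Measure.AbsolutelyContinuous.rfl.prod hYv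
  have hwv : μX.prod μW ≪ μX.prod volume := Measure.AbsolutelyContinuous.rfl.prod hWv
  have hfY : ∀ᵐ z ∂(μX.prod μY), J.rnDeriv (μX.prod volume) (e z) = μY.rnDeriv volume z.2 := by
    filter_upwards [hpv.ae_le hJrn, hpv.ae_le (hprod μY i2 hYv)] with z h1 h2
    rw [h1, h2]
  rw [← hXYprod] at hfY
  have hfY' := ae_of_ae_map hXY.aemeasurable hfY
  have hch := ae_of_ae_map hXW.aemeasurable (log_rnDeriv_chain hac hwv)
  have hfW := ae_of_ae_map hXW.aemeasurable ((hac.trans hwv).ae_le (hprod μW i3 hWv))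
  have key : ∀ᵐ ω ∂P, Real.log ((J.rnDeriv (μX.prod μW) (X ω, X ω + Y ω)).toReal)
      = Real.log ((μY.rnDeriv volume (Y ω)).toReal)
        - Real.log ((μW.rnDeriv volume (X ω + Y ω)).toReal) := by
    filter_upwards [hfY', hch, hfW] with ω h1 h2 h3
    rw [he] at h1
    rw [h2, h1, h3]
  have hmeas : Measurable fun x => Real.log ((J.rnDeriv (μX.prod μW) x).toReal) := by fun_prop
  unfold mutualInfo
  rw [heq, integral_map hXW.aemeasurable hmeas.aestronglyMeasurable, integral_congr_ae key,
    integral_sub hYi hWi]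

/-- For `X` with a density, mean `0` and covariance `Σ`, and an
independent `Z` with a density, mean `0` and covariance `I_p`, if the mutual
information `I(X; X_t)` and the non-Gaussianities `D(√t Z)` and `D(X_t)` are
finite, then
`I(X; X_t) = (1/2) log det(I_p + Σ/t) + D(√t Z) - D(X_t)`.
The non-Gaussianity of a centered vector with covariance `C` is the KL divergence
from its law to the centered Gaussian law with covariance `C` (realized as the
pushforward of the standard Gaussian under multiplication by `C^{1/2}`). -/
theorem stmt13 {Ω : Type*} [MeasurableSpace Ω] (P : Measure Ω) [IsProbabilityMeasure P]
    (p : ℕ) (t : ℝ) (ht : 0 < t)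
    (S Sthalf : Matrix (Fin p) (Fin p) ℝ) (hS : S.PosSemidef)
    -- `(Σ + t I_p)^{1/2}`:
    (hSthalf : Sthalf.PosSemidef)
    (hsqt : Sthalf * Sthalf = S + t • (1 : Matrix (Fin p) (Fin p) ℝ))
    (X Z : Ω → Fin p → ℝ) (hX : Measurable X) (hZ : Measurable Z)
    (hindep : IndepFun X Z P)
    -- `X` has a density, mean `0`, finite second moments and covariance `Σ`:
    (hXdens : P.map X ≪ (volume : Measure (Fin p → ℝ)))
    (hXint : ∀ i, Integrable (fun ω => X ω i) P)
    (hXmean : ∀ i, ∫ ω, X ω i ∂P = 0)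
    (hXsq : ∀ i j, Integrable (fun ω => X ω i * X ω j) P)
    (hXcov : ∀ i j, ∫ ω, X ω i * X ω j ∂P = S i j)
    -- `Z` has a density, mean `0`, finite second moments and covariance `I_p`:
    (hZdens : P.map Z ≪ (volume : Measure (Fin p → ℝ)))
    (hZint : ∀ i, Integrable (fun ω => Z ω i) P)
    (hZmean : ∀ i, ∫ ω, Z ω i ∂P = 0)
    (hZsq : ∀ i j, Integrable (fun ω => Z ω i * Z ω j) P)
    (hZcov : ∀ i j, ∫ ω, Z ω i * Z ω j ∂P = (1 : Matrix (Fin p) (Fin p) ℝ) i j)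
    -- finiteness assumptions:
    (hIfin : mutualInfo P X (fun ω => X ω + Real.sqrt t • Z ω) ≠ ⊤)
    (hD1fin : klDiv (P.map fun ω => Real.sqrt t • Z ω)
      ((stdGaussian p).map fun w => Real.sqrt t • w) ≠ ⊤)
    (hD2fin : klDiv (P.map fun ω => X ω + Real.sqrt t • Z ω)
      ((stdGaussian p).map fun w => Sthalf.mulVec w) ≠ ⊤) :
    mutualInfo P X (fun ω => X ω + Real.sqrt t • Z ω)
      = ((1 / 2 * Real.log ((1 + t⁻¹ • S).det) : ℝ) : EReal)
        + klDiv (P.map fun ω => Real.sqrt t • Z ω)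
            ((stdGaussian p).map fun w => Real.sqrt t • w)
        - klDiv (P.map fun ω => X ω + Real.sqrt t • Z ω)
            ((stdGaussian p).map fun w => Sthalf.mulVec w) := by
  have hst : 0 < √t := Real.sqrt_pos.mpr ht
  have hss : √t * √t = t := Real.mul_self_sqrt ht.le
  set Y : Ω → Fin p → ℝ := fun ω => √t • Z ω with hYdef
  have hY : Measurable Y := Measurable.const_smul hZ (√t)
  have hindY : IndepFun X Y P :=
    hindep.comp measurable_id (measurable_const_smul (√t) : Measurable fun z : Fin p → ℝ => √t • z)
  -- determinants
  have hdet : (S + t • (1 : Matrix (Fin p) (Fin p) ℝ)).det = t ^ p * (1 + t⁻¹ • S).det := by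
    have : S + t • (1 : Matrix (Fin p) (Fin p) ℝ) = t • (1 + t⁻¹ • S) := by
      rw [smul_add, smul_smul, mul_inv_cancel₀ ht.ne', one_smul, add_comm]
    rw [this, Matrix.det_smul, Fintype.card_fin]
  have hpd : (1 + t⁻¹ • S).PosDef :=
    Matrix.PosDef.one.add_posSemidef (hS.smul (inv_nonneg.mpr ht.le))
  have hdpos : 0 < (1 + t⁻¹ • S).det := hpd.det_pos
  have hsq : Sthalf.det * Sthalf.det = t ^ p * (1 + t⁻¹ • S).det := by
    rw [← Matrix.det_mul, hsqt, hdet]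
  have hA2 : Sthalf.det ≠ 0 := by
    intro h
    rw [h] at hsq
    have : 0 < t ^ p * (1 + t⁻¹ • S).det := by positivity
    linarith
  have hdA1 : (√t • (1 : Matrix (Fin p) (Fin p) ℝ)).det = √t ^ p := by
    rw [Matrix.det_smul, Fintype.card_fin, Matrix.det_one, mul_one]
  have hA1 : (√t • (1 : Matrix (Fin p) (Fin p) ℝ)).det ≠ 0 := by
    rw [hdA1]; positivity
  have hmap1 : (fun w : Fin p → ℝ => √t • w)
      = fun w => (√t • (1 : Matrix (Fin p) (Fin p) ℝ)).mulVec w := by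
    funext w
    rw [Matrix.smul_mulVec, Matrix.one_mulVec]
  have hYsq : ∀ i j, Integrable (fun ω => Y ω i * Y ω j) P := by
    intro i j
    refine ((hZsq i j).const_mul t).congr (ae_of_all _ fun ω => ?_)
    simp only [hYdef, Pi.smul_apply, smul_eq_mul]
    linear_combination (-(Z ω i * Z ω j)) * hss
  have hYcov : ∀ i j, ∫ ω, Y ω i * Y ω j ∂P = (t • (1 : Matrix (Fin p) (Fin p) ℝ)) i j := by
    intro i j
    rw [Matrix.smul_apply, ← hZcov, smul_eq_mul, ← integral_const_mul]
    refine integral_congr_ae (ae_of_all _ fun ω => ?_)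
    simp only [hYdef, Pi.smul_apply, smul_eq_mul]
    linear_combination (Z ω i * Z ω j) * hss
  have hXY : ∀ i j, Integrable (fun ω => X ω i * Y ω j) P ∧ ∫ ω, X ω i * Y ω j ∂P = 0 := by
    intro i j
    have hij : IndepFun (fun ω => X ω i) (fun ω => Y ω j) P :=
      hindY.comp (measurable_pi_apply i) (measurable_pi_apply j)
    have hYint : Integrable (fun ω => Y ω j) P := (hZint j).const_mul (√t)
    refine ⟨hij.integrable_mul (hXint i) hYint, ?_⟩
    have := hij.integral_mul_eq_mul_integral (hXint i).aestronglyMeasurable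
      hYint.aestronglyMeasurable
    simp only [Pi.mul_apply] at this
    rw [this, hXmean, zero_mul]
  have hexp : ∀ i j ω, (X ω + Y ω) i * (X ω + Y ω) j
      = (X ω i * X ω j + Y ω i * Y ω j) + (X ω i * Y ω j + X ω j * Y ω i) := by
    intro i j ω
    simp only [Pi.add_apply]
    ring
  have hWsq : ∀ i j, Integrable (fun ω => (X ω + Y ω) i * (X ω + Y ω) j) P := by
    intro i j
    simp_rw [hexp]
    exact ((hXsq i j).add (hYsq i j)).add ((hXY i j).1.add (hXY j i).1)
  have hWcov : ∀ i j, ∫ ω, (X ω + Y ω) i * (X ω + Y ω) j ∂P = (Sthalf * Sthalfᵀ) i j := by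
    intro i j
    simp_rw [hexp]
    have hsymm : Sthalfᵀ = Sthalf := by
      have := hSthalf.isHermitian
      rwa [Matrix.IsHermitian, Matrix.conjTranspose_eq_transpose_of_trivial] at this
    have h1 : Integrable (fun ω => X ω i * X ω j + Y ω i * Y ω j) P := (hXsq i j).add (hYsq i j)
    have h2 : Integrable (fun ω => X ω i * Y ω j + X ω j * Y ω i) P :=
      (hXY i j).1.add (hXY j i).1
    rw [integral_add h1 h2,
      integral_add (hXsq i j) (hYsq i j), integral_add (hXY i j).1 (hXY j i).1, hXcov, hYcov,
      (hXY i j).2, (hXY j i).2, hsymm, hsqt, Matrix.add_apply]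
    ring
  have hYcov' : ∀ i j, ∫ ω, Y ω i * Y ω j ∂P
      = ((√t • (1 : Matrix (Fin p) (Fin p) ℝ)) * (√t • (1 : Matrix (Fin p) (Fin p) ℝ))ᵀ) i j := by
    intro i j
    rw [hYcov, Matrix.transpose_smul, Matrix.transpose_one, smul_mul_smul_comm, hss, one_mul]
  rw [hmap1] at hD1fin ⊢
  obtain ⟨hYv, hYi, hD1⟩ := klDiv_gauss P _ hA1 Y hY hYsq hYcov' hD1fin
  obtain ⟨hWv, hWi, hD2⟩ := klDiv_gauss P _ hA2 (fun ω => X ω + Y ω) (hX.add hY) hWsq hWcov hD2fin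
  have hI := mutualInfo_formula P X Y hX hY hindY hYv hWv hYi hWi hIfin
  change mutualInfo P X (fun ω => X ω + Y ω) = _ + _
    - klDiv (P.map fun ω => X ω + Y ω) ((_root_.stdGaussian p).map fun w => Sthalf.mulVec w)
  rw [hI, hD1, hD2, ← EReal.coe_add,
    ← EReal.coe_sub]
  congr 1
  have hl : Real.log |Sthalf.det| + Real.log |Sthalf.det|
      = p * Real.log t + Real.log ((1 + t⁻¹ • S).det) := by
    rw [Real.log_abs, ← Real.log_mul hA2 hA2, hsq, Real.log_mul (by positivity) hdpos.ne',
      Real.log_pow]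
  have hl1 : Real.log |(√t • (1 : Matrix (Fin p) (Fin p) ℝ)).det| = p * (Real.log t / 2) := by
    rw [hdA1, Real.log_abs, Real.log_pow, Real.log_sqrt ht.le]
  rw [hl1]
  linarith
end

section
/- Let X be a real random variable with a density, mean 0, variance 1, and finite third absolute moment, and let Z be a standard Gaussian N(0,1) random variable independent of X. For θ > 0 let I(θ) = I(X; θX + Z) denote the mutual information between X and θX + Z. Then I(θ) = θ²/2 + o(θ²) as θ → 0⁺; that is, (I(θ) − θ²/2)/θ² → 0 as θ → 0⁺. -/
open MeasureTheory ProbabilityTheory Filter Topology Matrix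

open InformationTheory (klFun klFun_apply klFun_nonneg continuous_klFun measurable_klFun
  convexOn_klFun)

noncomputable def gL (θ x y : ℝ) : ℝ := Real.exp (θ * x * y - θ ^ 2 * x ^ 2 / 2)

noncomputable def gp (μ : Measure ℝ) (θ y : ℝ) : ℝ := ∫ x, gL θ x y ∂μ

lemma gL_pos (θ x y : ℝ) : 0 < gL θ x y := Real.exp_pos _

lemma gL_le (θ x y : ℝ) : gL θ x y ≤ Real.exp (y ^ 2 / 2) := by
  unfold gL
  apply Real.exp_le_exp.2
  nlinarith [sq_nonneg (θ * x - y)]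

lemma gL_cont (θ : ℝ) : Continuous (fun q : ℝ × ℝ => gL θ q.1 q.2) := by
  unfold gL; fun_prop

lemma gL_cont1 (θ y : ℝ) : Continuous (fun x : ℝ => gL θ x y) := by
  unfold gL; fun_prop

lemma gL_cont2 (θ x : ℝ) : Continuous (fun y : ℝ => gL θ x y) := by
  unfold gL; fun_prop

lemma gL_int (μ : Measure ℝ) [IsFiniteMeasure μ] (θ y : ℝ) :
    Integrable (fun x => gL θ x y) μ := by
  apply Integrable.of_bound (C := Real.exp (y ^ 2 / 2)) (gL_cont1 θ y).aestronglyMeasurable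
  exact Eventually.of_forall fun x => by
    rw [Real.norm_of_nonneg (gL_pos _ _ _).le]; exact gL_le _ _ _

lemma kl_gL_int (μ : Measure ℝ) [IsFiniteMeasure μ] (θ y : ℝ) :
    Integrable (fun x => klFun (gL θ x y)) μ := by
  obtain ⟨C, hC⟩ := (isCompact_Icc (a := (0:ℝ)) (b := Real.exp (y ^ 2 / 2))).exists_bound_of_continuousOn
    continuous_klFun.continuousOn
  apply Integrable.of_bound (C := C) (continuous_klFun.comp (gL_cont1 θ y)).aestronglyMeasurable
  exact Eventually.of_forall fun x => hC _ ⟨(gL_pos _ _ _).le, gL_le _ _ _⟩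

lemma gp_pos (μ : Measure ℝ) [IsProbabilityMeasure μ] (θ y : ℝ) : 0 < gp μ θ y := by
  unfold gp
  rw [integral_pos_iff_support_of_nonneg (fun x => (gL_pos _ _ _).le) (gL_int μ θ y)]
  have : Function.support (fun x => gL θ x y) = Set.univ := by
    ext x; simp [(gL_pos θ x y).ne']
  rw [this]; simp

lemma gp_meas (μ : Measure ℝ) [IsProbabilityMeasure μ] (θ : ℝ) : Measurable (gp μ θ) := by
  unfold gp
  have : StronglyMeasurable (fun q : ℝ × ℝ => gL θ q.2 q.1) :=
    ((gL_cont θ).comp continuous_swap).stronglyMeasurable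
  exact (this.integral_prod_right (ν := μ)).measurable

lemma klFun_le_sq {u : ℝ} (hu : 0 ≤ u) : klFun u ≤ (u - 1) ^ 2 := by
  rw [klFun_apply]
  rcases hu.eq_or_lt with h | h
  · subst h; simp
  · nlinarith [Real.log_le_sub_one_of_pos h, mul_le_mul_of_nonneg_left (Real.log_le_sub_one_of_pos h) hu]

lemma kl_gp_le (μ : Measure ℝ) [IsProbabilityMeasure μ] (θ y : ℝ) {A : Set ℝ}
    (hA : MeasurableSet A) (hA2 : 1 / 2 ≤ μ.real A) :
    klFun (gp μ θ y) ≤ 2 * (∫ x in A, (gL θ x y - 1) ∂μ) ^ 2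
      + ∫ x in Aᶜ, klFun (gL θ x y) ∂μ := by
  classical
  set w := μ.real A with hw
  have hw0 : 0 < w := by linarith
  set a := ∫ x in A, gL θ x y ∂μ with ha
  have ha0 : 0 ≤ a := integral_nonneg fun x => (gL_pos _ _ _).le
  set u := a / w with hu
  have hu0 : 0 ≤ u := by positivity
  have hLi := gL_int μ θ y
  have hki := kl_gL_int μ θ y
  set g : ℝ → ℝ := A.piecewise (fun _ => u) (fun x => gL θ x y) with hg
  have hgi : Integrable g μ :=
    Integrable.piecewise hA (integrable_const u).integrableOn hLi.integrableOn
  have hkg : klFun ∘ g = A.piecewise (fun _ => klFun u) (fun x => klFun (gL θ x y)) := by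
    ext x; by_cases hx : x ∈ A <;> simp [hg, hx]
  have hkgi : Integrable (klFun ∘ g) μ := by
    rw [hkg]
    exact Integrable.piecewise hA (integrable_const _).integrableOn hki.integrableOn
  have hJ := convexOn_klFun.map_integral_le (μ := μ) (f := g) continuous_klFun.continuousOn
    isClosed_Ici (Eventually.of_forall fun x => by
      by_cases hx : x ∈ A
      · simpa [hg, hx] using hu0
      · simpa [hg, hx] using (gL_pos _ _ _).le) hgi hkgi
  have h1 : ∫ x, g x ∂μ = gp μ θ y := by
    rw [hg, integral_piecewise hA (integrable_const u).integrableOn hLi.integrableOn]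
    rw [setIntegral_const, smul_eq_mul, ← hw, hu, mul_div_cancel₀ _ hw0.ne', ha,
      integral_add_compl hA hLi]
    rfl
  have h2 : ∫ x, klFun (g x) ∂μ = w * klFun u + ∫ x in Aᶜ, klFun (gL θ x y) ∂μ := by
    change ∫ x, (klFun ∘ g) x ∂μ = _
    rw [hkg, integral_piecewise hA (integrable_const _).integrableOn hki.integrableOn,
      setIntegral_const, smul_eq_mul]
  rw [h1, h2] at hJ
  refine hJ.trans ?_
  refine add_le_add ?_ le_rfl
  have h3 : ∫ x in A, (gL θ x y - 1) ∂μ = a - w := by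
    rw [integral_sub hLi.integrableOn (integrable_const _).integrableOn]
    simp [ha, hw]
  rw [h3]
  have h4 : w * klFun u ≤ w * (u - 1) ^ 2 := by gcongr; exact klFun_le_sq hu0
  have h5 : w * (u - 1) ^ 2 = (a - w) ^ 2 / w := by rw [hu]; field_simp
  have h6 : (a - w) ^ 2 / w ≤ 2 * (a - w) ^ 2 := by
    rw [div_le_iff₀ hw0]; nlinarith [sq_nonneg (a - w)]
  linarith

lemma exp_rem (s : ℝ) : |Real.exp s - 1 - s| ≤ s ^ 2 * Real.exp |s| := by
  have := Complex.norm_exp_sub_sum_le_norm_mul_exp (s : ℂ) 2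
  simp [Finset.sum_range_succ] at this
  rw [← sub_sub] at this
  exact_mod_cast this

lemma gL_rem {M θ x : ℝ} (y : ℝ) (hM : 0 ≤ M) (hθ : 0 < θ) (hθ1 : θ ≤ 1) (hx : |x| ≤ M) :
    |gL θ x y - 1 - θ * x * y| ≤ 3 * θ ^ 2 * Real.exp (2 * (M * |y| + M ^ 2 / 2)) := by
  set t := M * |y| + M ^ 2 / 2 with ht
  have ht0 : 0 ≤ t := by positivity
  set s := θ * x * y - θ ^ 2 * x ^ 2 / 2 with hs
  have hx2 : x ^ 2 ≤ M ^ 2 := by rw [← sq_abs]; gcongr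
  have h1 : |s| ≤ θ * t := by
    have e1 : |θ * x * y| ≤ θ * (M * |y|) := by
      rw [abs_mul, abs_mul, abs_of_pos hθ, mul_assoc]; gcongr
    have e2 : |θ ^ 2 * x ^ 2 / 2| ≤ θ * (M ^ 2 / 2) := by
      rw [abs_of_nonneg (by positivity), mul_div_assoc]
      gcongr
      nlinarith
    calc |s| ≤ _ := abs_sub _ _
      _ ≤ θ * t := by rw [ht, mul_add]; exact add_le_add e1 e2
  have h2 : |Real.exp s - 1 - s| ≤ 2 * θ ^ 2 * Real.exp (2 * t) := by
    refine (exp_rem s).trans ?_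
    have e1 : s ^ 2 ≤ θ ^ 2 * t ^ 2 := by
      rw [← sq_abs, ← mul_pow]; gcongr
    have e2 : Real.exp |s| ≤ Real.exp t := by
      apply Real.exp_le_exp.2; nlinarith
    have e3 : t ^ 2 ≤ 2 * Real.exp t := by
      have := Real.quadratic_le_exp_of_nonneg ht0; nlinarith
    calc s ^ 2 * Real.exp |s| ≤ (θ ^ 2 * (2 * Real.exp t)) * Real.exp t := by
          gcongr; exact e1.trans (by gcongr)
      _ = 2 * θ ^ 2 * Real.exp (2 * t) := by rw [show 2 * t = t + t by ring, Real.exp_add t t]; generalize Real.exp t = z; ring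
  have h3 : |θ ^ 2 * x ^ 2 / 2| ≤ θ ^ 2 * Real.exp (2 * t) := by
    rw [abs_of_nonneg (by positivity), mul_div_assoc]
    gcongr
    have := Real.add_one_le_exp (2 * t)
    have : M ^ 2 / 2 ≤ t := by rw [ht]; nlinarith [mul_nonneg hM (abs_nonneg y)]
    linarith
  have h4 : gL θ x y - 1 - θ * x * y = (Real.exp s - 1 - s) - θ ^ 2 * x ^ 2 / 2 := by
    rw [gL, ← hs]; rw [hs]; ring
  rw [h4]
  refine (abs_sub _ _).trans ?_
  linarith

lemma sq_bound (μ : Measure ℝ) [IsProbabilityMeasure μ] (hμ : Integrable (fun x : ℝ => x) μ)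
    {M θ : ℝ} (y : ℝ) (hM : 0 ≤ M) (hθ : 0 < θ) (hθ1 : θ ≤ 1) :
    (∫ x in {x : ℝ | |x| ≤ M}, (gL θ x y - 1) ∂μ) ^ 2 ≤
      2 * θ ^ 2 * (∫ x in {x : ℝ | |x| ≤ M}, x ∂μ) ^ 2 * y ^ 2
      + 18 * θ ^ 4 * Real.exp (2 * M ^ 2) * (Real.exp (4 * M * y) + Real.exp (-(4 * M) * y)) := by
  set A := {x : ℝ | |x| ≤ M} with hA
  have hAm : MeasurableSet A := measurableSet_le (by fun_prop) (by fun_prop)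
  set m := ∫ x in A, x ∂μ with hm
  set E := Real.exp (2 * (M * |y| + M ^ 2 / 2)) with hE
  have hR : Integrable (fun x => gL θ x y - 1 - θ * x * y) μ := by
    refine ((gL_int μ θ y).sub (integrable_const _)).sub ?_
    exact (hμ.const_mul θ).mul_const y
  have h1 : ∫ x in A, (gL θ x y - 1) ∂μ = θ * m * y + ∫ x in A, (gL θ x y - 1 - θ * x * y) ∂μ := by
    have : θ * m * y = ∫ x in A, θ * x * y ∂μ := by
      rw [integral_mul_const, integral_const_mul]
    rw [this, ← integral_add ((hμ.const_mul θ).mul_const y).integrableOn hR.integrableOn]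
    congr 1; ext x; ring
  have h2 : |∫ x in A, (gL θ x y - 1 - θ * x * y) ∂μ| ≤ 3 * θ ^ 2 * E := by
    have := norm_setIntegral_le_of_norm_le_const (μ := μ) (s := A) (measure_lt_top _ _)
      (f := fun x => gL θ x y - 1 - θ * x * y) (C := 3 * θ ^ 2 * E)
      (fun x hx => gL_rem y hM hθ hθ1 hx)
    refine this.trans ?_
    have : μ.real A ≤ 1 := measureReal_le_one
    have : 0 ≤ 3 * θ ^ 2 * E := by positivity
    nlinarith
  set R := ∫ x in A, (gL θ x y - 1 - θ * x * y) ∂μ with hRdef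
  rw [h1]
  have h3 : R ^ 2 ≤ 9 * θ ^ 4 * E ^ 2 := by
    have : R ^ 2 ≤ (3 * θ ^ 2 * E) ^ 2 := by rw [← sq_abs R]; gcongr
    nlinarith
  have h4 : E ^ 2 ≤ Real.exp (2 * M ^ 2) * (Real.exp (4 * M * y) + Real.exp (-(4 * M) * y)) := by
    have e1 : E ^ 2 = Real.exp (2 * M ^ 2) * Real.exp |4 * M * y| := by
      rw [hE, ← Real.exp_nat_mul, ← Real.exp_add, abs_mul, abs_of_nonneg (by positivity : 0 ≤ 4 * M)]
      congr 1; push_cast; ring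
    rw [e1, neg_mul]
    gcongr
    exact Real.exp_abs_le _
  have h5 : (θ * m * y + R) ^ 2 ≤ 2 * (θ * m * y) ^ 2 + 2 * R ^ 2 := by
    nlinarith [sq_nonneg (θ * m * y - R)]
  have h6 : 9 * θ ^ 4 * E ^ 2 ≤ 9 * θ ^ 4 * (Real.exp (2 * M ^ 2) * (Real.exp (4 * M * y) + Real.exp (-(4 * M) * y))) := by gcongr
  nlinarith

lemma gauss_sq_int (m : ℝ) : Integrable (fun y : ℝ => y ^ 2) (gaussianReal m 1) := by
  simpa using (memLp_id_gaussianReal (μ := m) (v := 1) 2).integrable_sq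

lemma gauss_id_int (m : ℝ) : Integrable (fun y : ℝ => y) (gaussianReal m 1) := by
  exact (memLp_id_gaussianReal (μ := m) (v := 1) 1).integrable (by simp)

lemma gauss_sq : ∫ y : ℝ, y ^ 2 ∂(gaussianReal 0 1) = 1 := by
  have h := variance_id_gaussianReal (μ := 0) (v := 1)
  rw [variance_eq_integral aemeasurable_id] at h
  simpa using h

lemma gauss_shift (θ x : ℝ) : gaussianReal (θ * x) 1 =
    (gaussianReal 0 1).withDensity (fun y => ENNReal.ofReal (gL θ x y)) := by
  have hm : Measurable (fun y => ENNReal.ofReal (gL θ x y)) :=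
    (gL_cont2 θ x).measurable.ennreal_ofReal
  rw [gaussianReal_of_var_ne_zero _ one_ne_zero, gaussianReal_of_var_ne_zero _ one_ne_zero,
    ← withDensity_mul _ (measurable_gaussianPDF _ _) hm]
  congr 1
  ext y
  simp only [gaussianPDF, Pi.mul_apply, gaussianPDFReal]
  rw [← ENNReal.ofReal_mul (by positivity), mul_assoc (_)⁻¹ (Real.exp _) (gL θ x y), gL,
    ← Real.exp_add]
  congr 3
  simp; ring

lemma kl_gL_lint (θ x : ℝ) : ∫⁻ y, ENNReal.ofReal (klFun (gL θ x y)) ∂(gaussianReal 0 1)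
    = ENNReal.ofReal (θ ^ 2 / 2 * x ^ 2) := by
  have hm : Measurable (fun y => ENNReal.ofReal (gL θ x y)) :=
    (gL_cont2 θ x).measurable.ennreal_ofReal
  have hfin : ∀ᵐ y ∂(gaussianReal 0 1), ENNReal.ofReal (gL θ x y) < ⊤ :=
    Eventually.of_forall fun _ => ENNReal.ofReal_lt_top
  have hli : Integrable (fun y : ℝ => θ * x * y - θ ^ 2 * x ^ 2 / 2) (gaussianReal (θ * x) 1) :=
    ((gauss_id_int _).const_mul _).sub (integrable_const _)
  have hlv : ∫ y, (θ * x * y - θ ^ 2 * x ^ 2 / 2) ∂(gaussianReal (θ * x) 1)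
      = θ ^ 2 / 2 * x ^ 2 := by
    rw [integral_sub ((gauss_id_int _).const_mul _) (integrable_const _), integral_const_mul,
      integral_id_gaussianReal]
    simp; ring
  have h1i : Integrable (fun y : ℝ => (1:ℝ)) (gaussianReal (θ * x) 1) := integrable_const _
  have h1v : ∫ y : ℝ, (1:ℝ) ∂(gaussianReal (θ * x) 1) = 1 := by simp
  rw [gauss_shift] at hli hlv h1i h1v
  rw [integrable_withDensity_iff_integrable_smul' hm hfin] at hli h1i
  rw [integral_withDensity_eq_integral_toReal_smul hm hfin] at hlv h1v
  simp only [ENNReal.toReal_ofReal (gL_pos _ _ _).le, smul_eq_mul, mul_one] at hli hlv h1i h1v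
  have hk : (fun y => klFun (gL θ x y)) =
      fun y => gL θ x y * (θ * x * y - θ ^ 2 * x ^ 2 / 2) + (1 - gL θ x y) := by
    ext y; rw [klFun_apply]
    have : Real.log (gL θ x y) = θ * x * y - θ ^ 2 * x ^ 2 / 2 := Real.log_exp _
    rw [this]; ring
  have hki : Integrable (fun y => klFun (gL θ x y)) (gaussianReal 0 1) := by
    rw [hk]; exact hli.add ((integrable_const _).sub h1i)
  rw [← ofReal_integral_eq_lintegral_ofReal hki
    (Eventually.of_forall fun y => klFun_nonneg (gL_pos _ _ _).le)]
  have h1i' : Integrable (fun y => 1 - gL θ x y) (gaussianReal 0 1) := (integrable_const _).sub h1i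
  rw [hk, integral_add hli h1i', integral_sub (integrable_const _) h1i, hlv, h1v]
  simp

lemma main_bound (μ : Measure ℝ) [IsProbabilityMeasure μ] (hμ : Integrable (fun x : ℝ => x) μ)
    (hμ2 : Integrable (fun x : ℝ => x ^ 2) μ)
    {M : ℝ} (hM : 0 ≤ M) (hA2 : 1 / 2 ≤ μ.real {x : ℝ | |x| ≤ M}) :
    ∃ C : ℝ, 0 ≤ C ∧ ∀ θ : ℝ, 0 < θ → θ ≤ 1 →
    ∫⁻ y, ENNReal.ofReal (klFun (gp μ θ y)) ∂(gaussianReal 0 1) ≤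
      ENNReal.ofReal (θ ^ 2 * (4 * (∫ x in {x : ℝ | |x| ≤ M}, x ∂μ) ^ 2
        + (∫ x in {x : ℝ | |x| ≤ M}ᶜ, x ^ 2 ∂μ) / 2 + C * θ ^ 2)) := by
  set A := {x : ℝ | |x| ≤ M} with hA
  have hAm : MeasurableSet A := measurableSet_le (by fun_prop) (by fun_prop)
  set m := ∫ x in A, x ∂μ with hm
  set G : ℝ → ℝ := fun y => Real.exp (4 * M * y) + Real.exp (-(4 * M) * y) with hG
  have hGi : Integrable G (gaussianReal 0 1) :=
    (integrable_exp_mul_gaussianReal _).add (integrable_exp_mul_gaussianReal _)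
  have hG0 : 0 ≤ ∫ y, G y ∂(gaussianReal 0 1) := integral_nonneg fun y => by
    simp only [hG]; positivity
  refine ⟨36 * Real.exp (2 * M ^ 2) * ∫ y, G y ∂(gaussianReal 0 1), by positivity, ?_⟩
  intro θ hθ hθ1
  set F : ℝ → ℝ := fun y => 4 * θ ^ 2 * m ^ 2 * y ^ 2 + 36 * θ ^ 4 * Real.exp (2 * M ^ 2) * G y
    with hF
  have hF0 : ∀ y, 0 ≤ F y := fun y => by simp only [hF, hG]; positivity
  have hFi : Integrable F (gaussianReal 0 1) :=
    ((gauss_sq_int 0).const_mul _).add (hGi.const_mul _)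
  have hFv : ∫ y, F y ∂(gaussianReal 0 1) = 4 * θ ^ 2 * m ^ 2
      + 36 * θ ^ 4 * Real.exp (2 * M ^ 2) * ∫ y, G y ∂(gaussianReal 0 1) := by
    rw [hF, integral_add ((gauss_sq_int 0).const_mul _) (hGi.const_mul _), integral_const_mul,
      integral_const_mul, gauss_sq, mul_one]
  have hpt : ∀ y, ENNReal.ofReal (klFun (gp μ θ y)) ≤ ENNReal.ofReal (F y)
      + ∫⁻ x in Aᶜ, ENNReal.ofReal (klFun (gL θ x y)) ∂μ := by
    intro y
    rw [← ofReal_integral_eq_lintegral_ofReal (kl_gL_int μ θ y).integrableOn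
      (Eventually.of_forall fun x => klFun_nonneg (gL_pos _ _ _).le),
      ← ENNReal.ofReal_add (hF0 y) (integral_nonneg fun x => klFun_nonneg (gL_pos _ _ _).le)]
    apply ENNReal.ofReal_le_ofReal
    refine (kl_gp_le μ θ y hAm hA2).trans ?_
    gcongr
    have := sq_bound μ hμ y hM hθ hθ1
    simp only [hF, hG]
    linarith
  refine (lintegral_mono hpt).trans ?_
  have hFm : Measurable F := by simp only [hF, hG]; fun_prop
  rw [lintegral_add_left hFm.ennreal_ofReal,
    ← ofReal_integral_eq_lintegral_ofReal hFi (Eventually.of_forall hF0), hFv,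
    lintegral_lintegral_swap]
  · simp_rw [kl_gL_lint]
    rw [← ofReal_integral_eq_lintegral_ofReal (hμ2.const_mul _).integrableOn
      (Eventually.of_forall fun x => by positivity), integral_const_mul,
      ← ENNReal.ofReal_add (by positivity)
        (mul_nonneg (by positivity) (integral_nonneg fun x => sq_nonneg x))]
    apply ENNReal.ofReal_le_ofReal
    apply le_of_eq
    ring
  · exact (continuous_klFun.comp ((gL_cont θ).comp continuous_swap)).measurable.ennreal_ofReal.aemeasurable

lemma joint_law {Ω : Type*} [MeasurableSpace Ω] (P : Measure Ω) [IsProbabilityMeasure P]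
    (X Z : Ω → ℝ) (hX : Measurable X) (hZ : Measurable Z)
    (hZlaw : P.map Z = gaussianReal 0 1) (hindep : IndepFun X Z P) (θ : ℝ) :
    P.map (fun ω => (X ω, θ * X ω + Z ω)) =
      ((P.map X).prod (gaussianReal 0 1)).withDensity
        (fun q => ENNReal.ofReal (gL θ q.1 q.2)) := by
  have hXZ := (indepFun_iff_map_prod_eq_prod_map_map hX.aemeasurable hZ.aemeasurable).1 hindep
  rw [hZlaw] at hXZ
  have : IsProbabilityMeasure (P.map X) := Measure.isProbabilityMeasure_map hX.aemeasurable
  have hT : Measurable (fun q : ℝ × ℝ => (q.1, θ * q.1 + q.2)) := by fun_prop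
  have h1 : P.map (fun ω => (X ω, θ * X ω + Z ω)) =
      ((P.map X).prod (gaussianReal 0 1)).map (fun q : ℝ × ℝ => (q.1, θ * q.1 + q.2)) := by
    rw [← hXZ, Measure.map_map hT (hX.prodMk hZ)]; rfl
  have hm : Measurable (fun q : ℝ × ℝ => ENNReal.ofReal (gL θ q.1 q.2)) :=
    (gL_cont θ).measurable.ennreal_ofReal
  rw [h1]
  ext s hs
  rw [Measure.map_apply hT hs, Measure.prod_apply (hT hs), withDensity_apply _ hs,
    ← lintegral_indicator hs, lintegral_prod _ (hm.indicator hs).aemeasurable]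
  congr 1
  ext x
  have h2 : gaussianReal (θ * x) 1 = (gaussianReal 0 1).map (fun z => θ * x + z) := by
    rw [gaussianReal_map_const_add, zero_add]
  have hsx : MeasurableSet (Prod.mk x ⁻¹' s) := measurable_prodMk_left hs
  have h3 : (gaussianReal (θ * x) 1) (Prod.mk x ⁻¹' s) =
      (gaussianReal 0 1) (Prod.mk x ⁻¹' ((fun q : ℝ × ℝ => (q.1, θ * q.1 + q.2)) ⁻¹' s)) := by
    rw [h2, Measure.map_apply (by fun_prop) hsx]; rfl
  rw [← h3, gauss_shift, withDensity_apply _ hsx, ← lintegral_indicator hsx]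
  rfl

lemma marg_law {Ω : Type*} [MeasurableSpace Ω] (P : Measure Ω) [IsProbabilityMeasure P]
    (X Z : Ω → ℝ) (hX : Measurable X) (hZ : Measurable Z)
    (hZlaw : P.map Z = gaussianReal 0 1) (hindep : IndepFun X Z P) (θ : ℝ) :
    P.map (fun ω => θ * X ω + Z ω) =
      (gaussianReal 0 1).withDensity (fun y => ENNReal.ofReal (gp (P.map X) θ y)) := by
  have : IsProbabilityMeasure (P.map X) := Measure.isProbabilityMeasure_map hX.aemeasurable
  have hY : Measurable (fun ω => θ * X ω + Z ω) := (hX.const_mul θ).add hZ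
  have hm : Measurable (fun q : ℝ × ℝ => ENNReal.ofReal (gL θ q.1 q.2)) :=
    (gL_cont θ).measurable.ennreal_ofReal
  have h1 : P.map (fun ω => θ * X ω + Z ω) =
      (P.map (fun ω => (X ω, θ * X ω + Z ω))).map Prod.snd := by
    rw [Measure.map_map measurable_snd (hX.prodMk hY)]; rfl
  rw [h1, joint_law P X Z hX hZ hZlaw hindep θ]
  ext s hs
  rw [Measure.map_apply measurable_snd hs, withDensity_apply _ (measurable_snd hs),
    withDensity_apply _ hs, ← Set.univ_prod, ← Measure.prod_restrict, Measure.restrict_univ,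
    lintegral_prod_symm _ hm.aemeasurable]
  congr 1
  ext y
  rw [gp, ofReal_integral_eq_lintegral_ofReal (gL_int _ θ y)
    (Eventually.of_forall fun x => (gL_pos _ _ _).le)]

lemma mi_eq {Ω : Type*} [MeasurableSpace Ω] (P : Measure Ω) [IsProbabilityMeasure P]
    (X Z : Ω → ℝ) (hX : Measurable X) (hZ : Measurable Z)
    (hXint : Integrable X P) (hXmean : ∫ ω, X ω ∂P = 0)
    (hXsq : Integrable (fun ω => X ω ^ 2) P) (hXvar : ∫ ω, X ω ^ 2 ∂P = 1)
    (hZlaw : P.map Z = gaussianReal 0 1) (hindep : IndepFun X Z P) (θ : ℝ)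
    (hfin : ∫⁻ y, ENNReal.ofReal (klFun (gp (P.map X) θ y)) ∂(gaussianReal 0 1) ≠ ⊤) :
    mutualInfo P X (fun ω => θ * X ω + Z ω) =
      ((θ ^ 2 / 2 - ∫ y, klFun (gp (P.map X) θ y) ∂(gaussianReal 0 1) : ℝ) : EReal) := by
  have : IsProbabilityMeasure (P.map X) := Measure.isProbabilityMeasure_map hX.aemeasurable
  have hY : Measurable (fun ω => θ * X ω + Z ω) := (hX.const_mul θ).add hZ
  have : IsProbabilityMeasure (P.map (fun ω => θ * X ω + Z ω)) :=
    Measure.isProbabilityMeasure_map hY.aemeasurable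
  have hpair : Measurable (fun ω => (X ω, θ * X ω + Z ω)) := hX.prodMk hY
  have hJ := joint_law P X Z hX hZ hZlaw hindep θ
  have hN := marg_law P X Z hX hZ hZlaw hindep θ
  set μ := P.map X with hμ
  set J := P.map (fun ω => (X ω, θ * X ω + Z ω)) with hJdef
  set ν := P.map (fun ω => θ * X ω + Z ω) with hν
  have hpm := gp_meas μ θ
  have hpp := gp_pos μ θ
  have hLm : Measurable (fun q : ℝ × ℝ => gL θ q.1 q.2) := (gL_cont θ).measurable
  have hDm : Measurable (fun q : ℝ × ℝ => ENNReal.ofReal (gL θ q.1 q.2 / gp μ θ q.2)) :=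
    (hLm.div (hpm.comp measurable_snd)).ennreal_ofReal
  have hpm2 : Measurable (fun q : ℝ × ℝ => ENNReal.ofReal (gp μ θ q.2)) :=
    (hpm.comp measurable_snd).ennreal_ofReal
  have hJ2 : J = (μ.prod ν).withDensity
      (fun q : ℝ × ℝ => ENNReal.ofReal (gL θ q.1 q.2 / gp μ θ q.2)) := by
    rw [hN, prod_withDensity_right hpm.ennreal_ofReal,
      ← withDensity_mul _ hpm2 hDm, hJ]
    congr 1
    ext q
    simp only [Pi.mul_apply]
    rw [← ENNReal.ofReal_mul (hpp _).le, mul_div_cancel₀ _ (hpp _).ne']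
  have hac : J ≪ μ.prod ν := by rw [hJ2]; exact withDensity_absolutelyContinuous _ _
  have hrn : (fun q : ℝ × ℝ => Real.log ((J.rnDeriv (μ.prod ν) q).toReal)) =ᵐ[J]
      fun q => (θ * q.1 * q.2 - θ ^ 2 * q.1 ^ 2 / 2) - Real.log (gp μ θ q.2) := by
    have h := Measure.rnDeriv_withDensity (μ.prod ν) hDm
    rw [← hJ2] at h
    filter_upwards [hac.ae_le h] with q hq
    rw [hq, ENNReal.toReal_ofReal (div_pos (gL_pos _ _ _) (hpp _)).le,
      Real.log_div (gL_pos _ _ _).ne' (hpp _).ne', gL, Real.log_exp]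
  -- first part
  have hZint : Integrable Z P := by
    have : Integrable (fun y : ℝ => y) (P.map Z) := by rw [hZlaw]; exact gauss_id_int 0
    exact this.comp_measurable hZ
  have hXZ : Integrable (fun ω => X ω * Z ω) P := hindep.integrable_mul hXint hZint
  have hXZ0 : ∫ ω, X ω * Z ω ∂P = 0 := by
    have := hindep.integral_mul_eq_mul_integral hXint.aestronglyMeasurable
      hZint.aestronglyMeasurable
    simp only [Pi.mul_apply] at this
    rw [this, hXmean, zero_mul]
  have hfe : (fun ω => θ * X ω * (θ * X ω + Z ω) - θ ^ 2 * X ω ^ 2 / 2) =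
      fun ω => θ ^ 2 / 2 * X ω ^ 2 + θ * (X ω * Z ω) := by ext ω; ring
  have hm1 : Measurable (fun q : ℝ × ℝ => θ * q.1 * q.2 - θ ^ 2 * q.1 ^ 2 / 2) := by fun_prop
  have h1i : Integrable (fun q : ℝ × ℝ => θ * q.1 * q.2 - θ ^ 2 * q.1 ^ 2 / 2) J := by
    rw [hJdef, integrable_map_measure hm1.aestronglyMeasurable hpair.aemeasurable]
    change Integrable (fun ω => θ * X ω * (θ * X ω + Z ω) - θ ^ 2 * X ω ^ 2 / 2) P
    rw [hfe]
    exact (hXsq.const_mul _).add (hXZ.const_mul _)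
  have h1v : ∫ q : ℝ × ℝ, (θ * q.1 * q.2 - θ ^ 2 * q.1 ^ 2 / 2) ∂J = θ ^ 2 / 2 := by
    rw [hJdef, integral_map hpair.aemeasurable hm1.aestronglyMeasurable, hfe,
      integral_add (hXsq.const_mul _) (hXZ.const_mul _), integral_const_mul, integral_const_mul,
      hXvar, hXZ0]
    ring
  -- second part
  have hlm : Measurable (fun y => Real.log (gp μ θ y)) := Real.measurable_log.comp hpm
  have hsnd : J.map Prod.snd = ν := by
    rw [hJdef, Measure.map_map measurable_snd hpair]; rfl
  have hpfin : ∀ᵐ y ∂(gaussianReal 0 1), ENNReal.ofReal (gp μ θ y) < ⊤ :=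
    Eventually.of_forall fun _ => ENNReal.ofReal_lt_top
  have hki : Integrable (fun y => klFun (gp μ θ y)) (gaussianReal 0 1) := by
    refine ⟨(measurable_klFun.comp hpm).aestronglyMeasurable, ?_⟩
    rw [hasFiniteIntegral_iff_ofReal (Eventually.of_forall fun y => klFun_nonneg (hpp y).le)]
    exact lt_top_iff_ne_top.2 hfin
  have hoi : Integrable (fun y : ℝ => (1:ℝ)) ν := integrable_const _
  have hov : ∫ y : ℝ, (1:ℝ) ∂ν = 1 := by simp
  rw [hN] at hoi hov
  rw [integrable_withDensity_iff_integrable_smul' hpm.ennreal_ofReal hpfin] at hoi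
  rw [integral_withDensity_eq_integral_toReal_smul hpm.ennreal_ofReal hpfin] at hov
  simp only [ENNReal.toReal_ofReal (hpp _).le, smul_eq_mul, mul_one] at hoi hov
  have hke : (fun y => gp μ θ y * Real.log (gp μ θ y)) =
      fun y => klFun (gp μ θ y) + (gp μ θ y - 1) := by
    ext y; rw [klFun_apply]; ring
  have hoi' : Integrable (fun y => gp μ θ y - 1) (gaussianReal 0 1) :=
    hoi.sub (integrable_const _)
  have h2i' : Integrable (fun y => Real.log (gp μ θ y)) ν := by
    rw [hN, integrable_withDensity_iff_integrable_smul' hpm.ennreal_ofReal hpfin]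
    simp only [ENNReal.toReal_ofReal (hpp _).le, smul_eq_mul]
    rw [hke]
    exact hki.add hoi'
  have h2v' : ∫ y, Real.log (gp μ θ y) ∂ν = ∫ y, klFun (gp μ θ y) ∂(gaussianReal 0 1) := by
    rw [hN, integral_withDensity_eq_integral_toReal_smul hpm.ennreal_ofReal hpfin]
    simp only [ENNReal.toReal_ofReal (hpp _).le, smul_eq_mul]
    rw [hke, integral_add hki hoi', integral_sub hoi (integrable_const _), hov]
    simp
  have h2i : Integrable (fun q : ℝ × ℝ => Real.log (gp μ θ q.2)) J := by
    rw [← hsnd] at h2i'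
    exact h2i'.comp_measurable measurable_snd
  have h2v : ∫ q : ℝ × ℝ, Real.log (gp μ θ q.2) ∂J
      = ∫ y, klFun (gp μ θ y) ∂(gaussianReal 0 1) := by
    rw [← h2v', ← hsnd, integral_map measurable_snd.aemeasurable hlm.aestronglyMeasurable]
  have hI : Integrable (fun q : ℝ × ℝ => Real.log ((J.rnDeriv (μ.prod ν) q).toReal)) J :=
    (integrable_congr hrn).2 (h1i.sub h2i)
  unfold mutualInfo klDiv
  rw [if_pos ⟨hac, hI⟩, integral_congr_ae hrn, integral_sub h1i h2i, h1v, h2v]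

/-- For a real random variable `X` with a density, mean `0`,
variance `1` and finite third absolute moment, and an independent standard
Gaussian `Z`, the mutual information `I(θ) = I(X; θX + Z)` satisfies
`I(θ) = θ²/2 + o(θ²)` as `θ → 0⁺`: it is eventually finite and
`(I(θ) - θ²/2)/θ² → 0`. -/
theorem stmt15 {Ω : Type*} [MeasurableSpace Ω] (P : Measure Ω) [IsProbabilityMeasure P]
    (X Z : Ω → ℝ) (hX : Measurable X) (hZ : Measurable Z)
    (hXdens : P.map X ≪ (volume : Measure ℝ))
    (hXint : Integrable X P) (hXmean : ∫ ω, X ω ∂P = 0)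
    (hXsq : Integrable (fun ω => X ω ^ 2) P) (hXvar : ∫ ω, X ω ^ 2 ∂P = 1)
    (hXthird : Integrable (fun ω => |X ω| ^ 3) P)
    (hZlaw : P.map Z = gaussianReal 0 1) (hindep : IndepFun X Z P) :
    (∀ᶠ θ in 𝓝[>] (0 : ℝ), mutualInfo P X (fun ω => θ * X ω + Z ω) ≠ ⊤) ∧
    Tendsto (fun θ : ℝ =>
        ((mutualInfo P X (fun ω => θ * X ω + Z ω)).toReal - θ ^ 2 / 2) / θ ^ 2)
      (𝓝[>] 0) (𝓝 0) := by
  have : IsProbabilityMeasure (P.map X) := Measure.isProbabilityMeasure_map hX.aemeasurable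
  set μ := P.map X with hμ
  have hi : Integrable (fun x : ℝ => x) μ := by
    rw [hμ, integrable_map_measure (by fun_prop) hX.aemeasurable]; exact hXint
  have hi2 : Integrable (fun x : ℝ => x ^ 2) μ := by
    rw [hμ, integrable_map_measure (by fun_prop) hX.aemeasurable]; exact hXsq
  have hmean : ∫ x, x ∂μ = 0 := by
    rw [hμ, integral_map hX.aemeasurable (by fun_prop)]; exact hXmean
  set A : ℕ → Set ℝ := fun n => {x : ℝ | |x| ≤ (n : ℝ)} with hA
  have hAm : ∀ n, MeasurableSet (A n) := fun n => measurableSet_le (by fun_prop) (by fun_prop)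
  have hAmono : Monotone A := fun a b hab x (hx : |x| ≤ (a : ℝ)) =>
    hx.trans (by exact_mod_cast hab)
  have hAU : ⋃ n, A n = Set.univ := by
    ext x; simpa [hA] using exists_nat_ge |x|
  have t1 : Tendsto (fun n => ∫ x in A n, x ∂μ) atTop (𝓝 0) := by
    have := tendsto_setIntegral_of_monotone (μ := μ) (f := fun x : ℝ => x) hAm hAmono
      hi.integrableOn
    rwa [hAU, Measure.restrict_univ, hmean] at this
  have t2 : Tendsto (fun n => ∫ x in (A n)ᶜ, x ^ 2 ∂μ) atTop (𝓝 0) := by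
    have := tendsto_setIntegral_of_antitone (μ := μ) (f := fun x : ℝ => x ^ 2)
      (s := fun n => (A n)ᶜ) (fun n => (hAm n).compl)
      (fun a b hab => Set.compl_subset_compl.2 (hAmono hab)) ⟨0, hi2.integrableOn⟩
    rwa [← Set.compl_iUnion, hAU, Set.compl_univ, Measure.restrict_empty,
      integral_zero_measure] at this
  have t3 : Tendsto (fun n => μ.real (A n)) atTop (𝓝 1) := by
    have := tendsto_setIntegral_of_monotone (μ := μ) (f := fun x : ℝ => (1 : ℝ)) hAm hAmono
      (integrable_const _).integrableOn
    rw [hAU, Measure.restrict_univ] at this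
    simpa using this
  have key : ∀ ε : ℝ, 0 < ε → ∀ᶠ θ in 𝓝[>] (0 : ℝ),
      ∫⁻ y, ENNReal.ofReal (klFun (gp μ θ y)) ∂(gaussianReal 0 1) ≤
        ENNReal.ofReal (θ ^ 2 * ε) := by
    intro ε hε
    have t4 : Tendsto (fun n => 4 * (∫ x in A n, x ∂μ) ^ 2 + (∫ x in (A n)ᶜ, x ^ 2 ∂μ) / 2)
        atTop (𝓝 0) := by
      have := ((t1.pow 2).const_mul 4).add (t2.div_const 2)
      simpa using this
    obtain ⟨n, hn1, hn2⟩ := ((t3.eventually (lt_mem_nhds (by norm_num : (1/2 : ℝ) < 1))).and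
      (t4.eventually (gt_mem_nhds (by linarith : 0 < ε / 2)))).exists
    obtain ⟨C, hC0, hC⟩ := main_bound μ hi hi2 (Nat.cast_nonneg n) hn1.le
    have t5 : Tendsto (fun θ : ℝ => C * θ ^ 2) (𝓝[>] 0) (𝓝 0) := by
      have : Tendsto (fun θ : ℝ => C * θ ^ 2) (𝓝 0) (𝓝 (C * 0 ^ 2)) :=
        Continuous.tendsto (by fun_prop) 0
      simp only [ne_eq, OfNat.ofNat_ne_zero, not_false_eq_true, zero_pow, mul_zero] at this
      exact this.mono_left nhdsWithin_le_nhds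
    filter_upwards [self_mem_nhdsWithin, Ioc_mem_nhdsGT (zero_lt_one' ℝ),
      t5.eventually (gt_mem_nhds (by linarith : 0 < ε / 2))] with θ h0 h1 h2
    refine (hC θ h1.1 h1.2).trans (ENNReal.ofReal_le_ofReal ?_)
    gcongr
    linarith
  have hmi : ∀ ε : ℝ, 0 < ε → ∀ᶠ θ in 𝓝[>] (0 : ℝ),
      ∃ D : ℝ, 0 ≤ D ∧ D ≤ θ ^ 2 * ε ∧
        mutualInfo P X (fun ω => θ * X ω + Z ω) = ((θ ^ 2 / 2 - D : ℝ) : EReal) := by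
    intro ε hε
    filter_upwards [key ε hε] with θ hθ
    have hnn : ∀ y, 0 ≤ klFun (gp μ θ y) := fun y => klFun_nonneg (gp_pos μ θ y).le
    refine ⟨_, integral_nonneg hnn, ?_, mi_eq P X Z hX hZ hXint hXmean hXsq hXvar hZlaw hindep θ
      (ne_top_of_le_ne_top ENNReal.ofReal_ne_top hθ)⟩
    rw [integral_eq_lintegral_of_nonneg_ae (Eventually.of_forall hnn)
      (measurable_klFun.comp (gp_meas μ θ)).aestronglyMeasurable]
    exact ENNReal.toReal_le_of_le_ofReal (by positivity) hθ
  constructor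
  · filter_upwards [hmi 1 one_pos] with θ ⟨D, _, _, h⟩
    rw [h]; exact EReal.coe_ne_top _
  · rw [Metric.tendsto_nhds]
    intro ε hε
    filter_upwards [hmi (ε / 2) (by linarith), self_mem_nhdsWithin] with θ ⟨D, hD0, hD, h⟩ hθ
    have hθ' : (0:ℝ) < θ := hθ
    rw [h, EReal.toReal_coe, dist_zero_right, Real.norm_eq_abs,
      show (θ ^ 2 / 2 - D - θ ^ 2 / 2) / θ ^ 2 = -(D / θ ^ 2) by ring, abs_neg,
      abs_of_nonneg (by positivity), div_lt_iff₀ (by positivity)]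
    nlinarith [pow_pos hθ' 2]
end

section
/- Let p ∈ ℕ and let X be a random vector in ℝ^p with a density, mean 0, covariance matrix Σ, and finite third absolute moments in each coordinate, and let Z be a standard Gaussian random vector in ℝ^p independent of X. For θ > 0 let I(θ) = I(X; θX + Z). Then I(θ) ≤ p·Tr(Σ)·θ²/2 + o(θ²) as θ → 0⁺; that is, limsup_{θ→0⁺} (I(θ) − p·Tr(Σ)·θ²/2)/θ² ≤ 0. -/
open MeasureTheory ProbabilityTheory Filter Topology Matrix

open scoped ENNReal

lemma aux_gauss1 (a : ℝ) :
    (gaussianReal 0 1).map (fun y => a + y) =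
      (gaussianReal 0 1).withDensity (fun y => ENNReal.ofReal (Real.exp (a * y - a ^ 2 / 2))) := by
  rw [gaussianReal_map_const_add, gaussianReal_of_var_ne_zero _ one_ne_zero,
    gaussianReal_of_var_ne_zero _ one_ne_zero,
    ← withDensity_mul _ (measurable_gaussianPDF _ _) (by fun_prop)]
  congr 1
  ext y
  simp only [Pi.mul_apply, gaussianPDF, gaussianPDFReal]
  rw [← ENNReal.ofReal_mul (by positivity), mul_assoc _ (Real.exp _) (Real.exp _), ← Real.exp_add]
  congr 3
  simp
  ring

lemma aux_pi_withDensity {p : ℕ} (f : Fin p → ℝ → ℝ≥0∞) (hf : ∀ i, Measurable (f i))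
    [∀ i, SigmaFinite ((gaussianReal 0 1).withDensity (f i))] :
    Measure.pi (fun i => (gaussianReal 0 1).withDensity (f i)) =
      (_root_.stdGaussian p).withDensity (fun y => ∏ i, f i (y i)) := by
  refine Measure.pi_eq fun s hs => ?_
  rw [withDensity_apply _ (.univ_pi hs), ← lintegral_indicator (.univ_pi hs)]
  have h1 : ∀ y : Fin p → ℝ, (Set.univ.pi s).indicator (fun y => ∏ i, f i (y i)) y
      = ∏ i, (s i).indicator (f i) (y i) := by
    intro y
    by_cases hy : y ∈ Set.univ.pi s
    · rw [Set.indicator_of_mem hy]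
      refine Finset.prod_congr rfl fun i _ => ?_
      rw [Set.indicator_of_mem (hy i trivial)]
    · rw [Set.indicator_of_notMem hy]
      simp only [Set.mem_pi, Set.mem_univ, forall_true_left, not_forall] at hy
      obtain ⟨i, hi⟩ := hy
      symm
      exact Finset.prod_eq_zero (Finset.mem_univ i) (Set.indicator_of_notMem hi _)
  simp_rw [h1]
  have hm : ∀ i, Measurable ((s i).indicator (f i)) := fun i => (hf i).indicator (hs i)
  rw [_root_.stdGaussian, lintegral_prod_eq_prod_lintegral_of_indepFun Finset.univ
    (fun i (y : Fin p → ℝ) => (s i).indicator (f i) (y i))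
    (iIndepFun_pi (fun i => (hm i).aemeasurable))
    (fun i => (hm i).comp (measurable_pi_apply i))]
  refine Finset.prod_congr rfl fun i _ => ?_
  rw [(measurePreserving_eval (fun _ : Fin p => gaussianReal 0 1) i).lintegral_comp (hm i),
    lintegral_indicator (hs i), withDensity_apply _ (hs i)]

lemma aux_gaussp {p : ℕ} (a : Fin p → ℝ) :
    (_root_.stdGaussian p).map (fun y => a + y) =
      (_root_.stdGaussian p).withDensity
        (fun y => ENNReal.ofReal (Real.exp (∑ i, (a i * y i - a i ^ 2 / 2)))) := by
  have hpm : ∀ i : Fin p, IsProbabilityMeasure ((gaussianReal 0 1).map (fun y => a i + y)) :=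
    fun i => Measure.isProbabilityMeasure_map (by fun_prop)
  have h := Measure.pi_map_pi (μ := fun _ : Fin p => gaussianReal 0 1)
    (f := fun i y => a i + y) (fun i => by fun_prop)
  have h2 : ∀ i : Fin p, IsProbabilityMeasure ((gaussianReal 0 1).withDensity
      (fun y => ENNReal.ofReal (Real.exp (a i * y - a i ^ 2 / 2)))) := by
    intro i; rw [← aux_gauss1]; exact hpm i
  have e : (fun y : Fin p → ℝ => a + y) = fun y i => a i + y i := rfl
  rw [e, _root_.stdGaussian, h]
  simp_rw [aux_gauss1]
  rw [aux_pi_withDensity _ (fun i => by fun_prop), _root_.stdGaussian]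
  congr 1
  ext y
  rw [Real.exp_sum, ENNReal.ofReal_prod_of_nonneg (fun _ _ => (Real.exp_pos _).le)]

instance {p : ℕ} : IsProbabilityMeasure (_root_.stdGaussian p) := by
  unfold _root_.stdGaussian; infer_instance

/-- log density -/
noncomputable def gfun (p : ℕ) (θ : ℝ) (q : (Fin p → ℝ) × (Fin p → ℝ)) : ℝ :=
  ∑ i, (θ * q.1 i * q.2 i - (θ * q.1 i) ^ 2 / 2)

lemma measurable_gfun (p : ℕ) (θ : ℝ) : Measurable (gfun p θ) := by
  unfold gfun; fun_prop

lemma aux_joint {p : ℕ} (θ : ℝ) (μ : Measure (Fin p → ℝ)) [IsProbabilityMeasure μ] :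
    (μ.prod (_root_.stdGaussian p)).map (fun q => (q.1, θ • q.1 + q.2)) =
      (μ.prod (_root_.stdGaussian p)).withDensity (fun q => ENNReal.ofReal (Real.exp (gfun p θ q))) := by
  have hg := measurable_gfun p θ
  have hT : Measurable (fun q : (Fin p → ℝ) × (Fin p → ℝ) => (q.1, θ • q.1 + q.2)) := by fun_prop
  ext s hs
  rw [Measure.map_apply hT hs, Measure.prod_apply (hT hs), withDensity_apply _ hs,
    ← lintegral_indicator hs, lintegral_prod _ (by
      apply Measurable.aemeasurable; exact Measurable.indicator (by fun_prop) hs)]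
  refine lintegral_congr fun x => ?_
  have hsx : MeasurableSet (Prod.mk x ⁻¹' s) := measurable_prodMk_left hs
  have h := congrArg (fun m => m (Prod.mk x ⁻¹' s)) (aux_gaussp (θ • x))
  beta_reduce at h
  rw [Measure.map_apply (by fun_prop) hsx, withDensity_apply _ hsx, ← lintegral_indicator hsx] at h
  exact h

/-- golden inequality -/
lemma aux_golden {p : ℕ} (J : Measure ((Fin p → ℝ) × (Fin p → ℝ))) [IsProbabilityMeasure J]
    (μ γ : Measure (Fin p → ℝ)) [IsProbabilityMeasure μ] [IsProbabilityMeasure γ] :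
    InformationTheory.klDiv J (μ.prod J.snd) ≤ InformationTheory.klDiv J (μ.prod γ) := by
  have hJ' : IsProbabilityMeasure (J.map Prod.swap) :=
    Measure.isProbabilityMeasure_map (by fun_prop)
  have hfst : (J.map Prod.swap).fst = J.snd := by
    rw [Measure.fst, Measure.map_map (by fun_prop) (by fun_prop)]; rfl
  have hd : J.snd ⊗ₘ (J.map Prod.swap).condKernel = J.map Prod.swap := by
    rw [← hfst]; exact Measure.disintegrate _ _
  have h1 := InformationTheory.klDiv_map_le (J.map Prod.swap) (J.snd.prod μ)
    (g := Prod.swap) measurable_swap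
  have h2 := InformationTheory.klDiv_map_le J (μ.prod γ) (g := Prod.swap) measurable_swap
  have h3 := InformationTheory.klDiv_compProd_eq_add J.snd γ (J.map Prod.swap).condKernel
    (Kernel.const _ μ)
  rw [hd, Measure.compProd_const, Measure.compProd_const] at h3
  rw [Measure.map_map (by fun_prop) (by fun_prop), Measure.prod_swap] at h1
  simp only [Prod.swap_swap_eq, Measure.map_id] at h1
  rw [Measure.prod_swap] at h2
  calc _ ≤ _ := h1
    _ ≤ _ := by rw [h3]; exact le_add_self
    _ ≤ _ := h2

lemma aux_klDiv {α : Type*} [MeasurableSpace α] (μ ν : Measure α) [IsProbabilityMeasure μ]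
    [IsProbabilityMeasure ν] (h : InformationTheory.klDiv μ ν ≠ ∞) :
    klDiv μ ν ≠ ⊤ ∧ (klDiv μ ν).toReal = (InformationTheory.klDiv μ ν).toReal := by
  obtain ⟨h1, h2⟩ := InformationTheory.klDiv_ne_top_iff.1 h
  have e : klDiv μ ν = ((∫ x, Real.log ((μ.rnDeriv ν x).toReal) ∂μ : ℝ) : EReal) := by
    unfold klDiv
    exact if_pos ⟨h1, h2⟩
  rw [e, InformationTheory.toReal_klDiv_of_measure_eq h1 (by simp)]
  exact ⟨EReal.coe_ne_top _, rfl⟩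

lemma aux_main {Ω : Type*} [MeasurableSpace Ω] (P : Measure Ω) [IsProbabilityMeasure P]
    (p : ℕ) (S : Matrix (Fin p) (Fin p) ℝ)
    (X Z : Ω → Fin p → ℝ) (hX : Measurable X) (hZ : Measurable Z)
    (hXint : ∀ i, Integrable (fun ω => X ω i) P)
    (hXsq : ∀ i j, Integrable (fun ω => X ω i * X ω j) P)
    (hXcov : ∀ i j, ∫ ω, X ω i * X ω j ∂P = S i j)
    (hZlaw : P.map Z = _root_.stdGaussian p) (hindep : IndepFun X Z P) (θ : ℝ) :
    mutualInfo P X (fun ω => θ • X ω + Z ω) ≠ ⊤ ∧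
      (mutualInfo P X (fun ω => θ • X ω + Z ω)).toReal ≤ S.trace * θ ^ 2 / 2 := by
  have hg := measurable_gfun p θ
  have hY : Measurable (fun ω => θ • X ω + Z ω) := by fun_prop
  have hXY : Measurable (fun ω => (X ω, θ • X ω + Z ω)) := by fun_prop
  have pX : IsProbabilityMeasure (P.map X) := Measure.isProbabilityMeasure_map hX.aemeasurable
  have pY : IsProbabilityMeasure (P.map (fun ω => θ • X ω + Z ω)) :=
    Measure.isProbabilityMeasure_map hY.aemeasurable
  have pJ : IsProbabilityMeasure (P.map (fun ω => (X ω, θ • X ω + Z ω))) :=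
    Measure.isProbabilityMeasure_map hXY.aemeasurable
  have hJ : P.map (fun ω => (X ω, θ • X ω + Z ω)) = ((P.map X).prod (_root_.stdGaussian p)).withDensity
      (fun q => ENNReal.ofReal (Real.exp (gfun p θ q))) := by
    rw [← aux_joint, ← hZlaw, ← (indepFun_iff_map_prod_eq_prod_map_map hX.aemeasurable
      hZ.aemeasurable).1 hindep, Measure.map_map (by fun_prop) (by fun_prop)]
    rfl
  have hac : P.map (fun ω => (X ω, θ • X ω + Z ω)) ≪ (P.map X).prod (_root_.stdGaussian p) := by
    rw [hJ]; exact withDensity_absolutelyContinuous _ _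
  have hllr : llr (P.map (fun ω => (X ω, θ • X ω + Z ω))) ((P.map X).prod (_root_.stdGaussian p))
      =ᵐ[P.map (fun ω => (X ω, θ • X ω + Z ω))] gfun p θ := by
    apply hac.ae_le
    have := Measure.rnDeriv_withDensity ((P.map X).prod (_root_.stdGaussian p))
      (f := fun q => ENNReal.ofReal (Real.exp (gfun p θ q))) (by fun_prop)
    rw [← hJ] at this
    filter_upwards [this] with q hq
    rw [llr, hq, ENNReal.toReal_ofReal (Real.exp_pos _).le, Real.log_exp]
  have hZi : ∀ i, Integrable (fun ω => Z ω i) P ∧ ∫ ω, Z ω i ∂P = 0 := by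
    intro i
    have hm : P.map (fun ω => Z ω i) = gaussianReal 0 1 := by
      rw [← (measurePreserving_eval (fun _ : Fin p => gaussianReal 0 1) i).map_eq,
        ← _root_.stdGaussian, ← hZlaw, Measure.map_map (by fun_prop) hZ]
      rfl
    have hmi : AEMeasurable (fun ω => Z ω i) P := by fun_prop
    constructor
    · have : Integrable id (P.map (fun ω => Z ω i)) := by
        rw [hm]; exact (memLp_id_gaussianReal 1).integrable (by simp)
      exact (integrable_map_measure (by fun_prop) hmi).1 this
    · have := integral_map hmi (f := fun x : ℝ => x) (by fun_prop)
      rw [← this, hm, integral_id_gaussianReal]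
  have hind : ∀ i, IndepFun (fun ω => X ω i) (fun ω => Z ω i) P := fun i =>
    hindep.comp (measurable_pi_apply i) (measurable_pi_apply i)
  have hXZ : ∀ i, Integrable (fun ω => X ω i * Z ω i) P := fun i =>
    (hind i).integrable_mul (hXint i) (hZi i).1
  have hXZ0 : ∀ i, ∫ ω, X ω i * Z ω i ∂P = 0 := fun i => by
    rw [(hind i).integral_fun_mul_eq_mul_integral (by fun_prop) (by fun_prop), (hZi i).2, mul_zero]
  have hgc : (fun ω => gfun p θ (X ω, θ • X ω + Z ω)) =
      fun ω => ∑ i, (θ ^ 2 / 2 * (X ω i * X ω i) + θ * (X ω i * Z ω i)) := by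
    ext ω
    refine Finset.sum_congr rfl fun i _ => ?_
    simp only [Pi.add_apply, Pi.smul_apply, smul_eq_mul]
    ring
  have hterm : ∀ i, Integrable (fun ω => θ ^ 2 / 2 * (X ω i * X ω i) + θ * (X ω i * Z ω i)) P :=
    fun i => ((hXsq i i).const_mul _).add ((hXZ i).const_mul _)
  have hgint : Integrable (gfun p θ) (P.map (fun ω => (X ω, θ • X ω + Z ω))) := by
    rw [integrable_map_measure hg.aestronglyMeasurable hXY.aemeasurable]
    change Integrable (fun ω => gfun p θ (X ω, θ • X ω + Z ω)) P
    rw [hgc]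
    exact integrable_finsetSum _ fun i _ => hterm i
  have hgval : ∫ q, gfun p θ q ∂(P.map (fun ω => (X ω, θ • X ω + Z ω))) = S.trace * θ ^ 2 / 2 := by
    rw [integral_map hXY.aemeasurable hg.aestronglyMeasurable, hgc,
      integral_finsetSum _ fun i _ => hterm i]
    have : ∀ i, ∫ ω, (θ ^ 2 / 2 * (X ω i * X ω i) + θ * (X ω i * Z ω i)) ∂P
        = θ ^ 2 / 2 * S i i := by
      intro i
      rw [integral_add ((hXsq i i).const_mul _) ((hXZ i).const_mul _), integral_const_mul,
        integral_const_mul, hXcov, hXZ0]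
      ring
    simp_rw [this, ← Finset.mul_sum]
    simp only [Matrix.trace, Matrix.diag_apply]
    ring
  have hllrint := hgint.congr hllr.symm
  have hfin := InformationTheory.klDiv_ne_top hac hllrint
  have hval := InformationTheory.toReal_klDiv_of_measure_eq hac (by simp)
  rw [integral_congr_ae hllr, hgval] at hval
  have hgold := aux_golden (P.map (fun ω => (X ω, θ • X ω + Z ω))) (P.map X) (_root_.stdGaussian p)
  have hsnd : (P.map (fun ω => (X ω, θ • X ω + Z ω))).snd = P.map (fun ω => θ • X ω + Z ω) := by
    rw [Measure.snd, Measure.map_map (by fun_prop) hXY]; rfl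
  rw [hsnd] at hgold
  obtain ⟨k1, k2⟩ := aux_klDiv _ _ (ne_top_of_le_ne_top hfin hgold)
  refine ⟨k1, ?_⟩
  unfold mutualInfo
  rw [k2, ← hval]
  exact ENNReal.toReal_mono hfin hgold

/-- For a random vector `X` in `ℝ^p` with a density, mean `0`,
covariance `Σ` and finite third absolute moments in each coordinate, and an
independent standard Gaussian vector `Z`, the mutual information
`I(θ) = I(X; θX + Z)` satisfies `I(θ) ≤ p·Tr(Σ)·θ²/2 + o(θ²)` as `θ → 0⁺`:
it is eventually finite and `limsup_{θ→0⁺} (I(θ) - p·Tr(Σ)·θ²/2)/θ² ≤ 0`. -/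
theorem stmt16 {Ω : Type*} [MeasurableSpace Ω] (P : Measure Ω) [IsProbabilityMeasure P]
    (p : ℕ) (S : Matrix (Fin p) (Fin p) ℝ)
    (X Z : Ω → Fin p → ℝ) (hX : Measurable X) (hZ : Measurable Z)
    (hXdens : P.map X ≪ (volume : Measure (Fin p → ℝ)))
    (hXint : ∀ i, Integrable (fun ω => X ω i) P)
    (hXmean : ∀ i, ∫ ω, X ω i ∂P = 0)
    (hXsq : ∀ i j, Integrable (fun ω => X ω i * X ω j) P)
    (hXcov : ∀ i j, ∫ ω, X ω i * X ω j ∂P = S i j)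
    (hXthird : ∀ i, Integrable (fun ω => |X ω i| ^ 3) P)
    (hZlaw : P.map Z = stdGaussian p) (hindep : IndepFun X Z P) :
    (∀ᶠ θ in 𝓝[>] (0 : ℝ), mutualInfo P X (fun ω => θ • X ω + Z ω) ≠ ⊤) ∧
    Filter.limsup (fun θ : ℝ =>
        ((mutualInfo P X (fun ω => θ • X ω + Z ω)).toReal
          - (p : ℝ) * S.trace * θ ^ 2 / 2) / θ ^ 2)
      (𝓝[>] 0) ≤ 0 := by
  have main := aux_main P p S X Z hX hZ hXint hXsq hXcov hZlaw hindep
  refine ⟨Eventually.of_forall fun θ => (main θ).1, ?_⟩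
  have htr0 : 0 ≤ S.trace := by
    refine Finset.sum_nonneg fun i _ => ?_
    rw [Matrix.diag_apply, ← hXcov i i]
    exact integral_nonneg fun ω => mul_self_nonneg _
  have htr : S.trace ≤ (p : ℝ) * S.trace := by
    rcases Nat.eq_zero_or_pos p with h | h
    · subst h; simp [Matrix.trace]
    · have : (1 : ℝ) ≤ p := by exact_mod_cast h
      nlinarith
  have hev : ∀ᶠ θ in 𝓝[>] (0 : ℝ), ((mutualInfo P X (fun ω => θ • X ω + Z ω)).toReal
          - (p : ℝ) * S.trace * θ ^ 2 / 2) / θ ^ 2 ≤ 0 := by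
    refine Eventually.of_forall fun θ => div_nonpos_of_nonpos_of_nonneg ?_ (sq_nonneg θ)
    have := (main θ).2
    nlinarith [mul_le_mul_of_nonneg_right htr (sq_nonneg θ)]
  rw [Filter.limsup_eq]
  by_cases hb : BddBelow {a : ℝ | ∀ᶠ θ in 𝓝[>] (0 : ℝ),
      ((mutualInfo P X (fun ω => θ • X ω + Z ω)).toReal
          - (p : ℝ) * S.trace * θ ^ 2 / 2) / θ ^ 2 ≤ a}
  · exact csInf_le hb hev
  · exact (Real.sInf_of_not_bddBelow hb).le
end

section
/- (I-MMSE relation in the paper's parametrization.) Let X be a random vector in ℝ^p with E‖X‖² < ∞, and let Z be a standard Gaussian random vector in ℝ^p independent of X. For t > 0, define P_IT(t) = I(X; X + √t·Z) (mutual information) and P_ET(t) = E[‖X − E[X | X + √t·Z]‖²] (MMSE). Then for every t > 0, P_IT is differentiable at t and P_ET(t) = −2t²·P_IT′(t). -/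
open MeasureTheory ProbabilityTheory Filter Topology Matrix

namespace IMMSE

/-- unnormalized Gaussian kernel -/
noncomputable def kk {p : ℕ} (t : ℝ) (y x : Fin p → ℝ) : ℝ :=
  Real.exp (-(∑ i, (y i - x i) ^ 2) / (2 * t))

noncomputable def KK {p : ℕ} (μ : Measure (Fin p → ℝ)) (t : ℝ) (y : Fin p → ℝ) : ℝ :=
  ∫ x, kk t y x ∂μ

/-- posterior average of `φ` given `y` -/
noncomputable def avg {p : ℕ} (μ : Measure (Fin p → ℝ)) (t : ℝ) (φ : (Fin p → ℝ) → ℝ)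
    (y : Fin p → ℝ) : ℝ :=
  (∫ x, φ x * kk t y x ∂μ) / KK μ t y

section basics
variable {p : ℕ}

lemma kk_pos (t : ℝ) (y x : Fin p → ℝ) : 0 < kk t y x := Real.exp_pos _

lemma kk_le_one {t : ℝ} (ht : 0 < t) (y x : Fin p → ℝ) : kk t y x ≤ 1 := by
  unfold kk
  rw [Real.exp_le_one_iff]
  apply div_nonpos_of_nonpos_of_nonneg
  · exact neg_nonpos.2 (Finset.sum_nonneg fun i _ => sq_nonneg _)
  · positivity

lemma measurable_kk (t : ℝ) :
    Measurable (fun q : (Fin p → ℝ) × (Fin p → ℝ) => kk t q.2 q.1) := by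
  unfold kk
  fun_prop

lemma measurable_kk' (t : ℝ) (y : Fin p → ℝ) :
    Measurable (fun x : (Fin p → ℝ) => kk t y x) := by
  unfold kk
  fun_prop

lemma integrable_kk (μ : Measure (Fin p → ℝ)) [IsProbabilityMeasure μ] {t : ℝ} (ht : 0 < t)
    (y : Fin p → ℝ) : Integrable (fun x => kk t y x) μ := by
  refine Integrable.of_bound (measurable_kk' t y).aestronglyMeasurable 1 ?_
  filter_upwards with x
  rw [Real.norm_of_nonneg (kk_pos _ _ _).le]
  exact kk_le_one ht _ _

lemma integrable_mul_kk (μ : Measure (Fin p → ℝ)) {t : ℝ} (ht : 0 < t)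
    {φ : (Fin p → ℝ) → ℝ} (hφ : Integrable φ μ)
    (y : Fin p → ℝ) : Integrable (fun x => φ x * kk t y x) μ := by
  refine hφ.mul_bdd (c := 1) (measurable_kk' t y).aestronglyMeasurable ?_
  filter_upwards with x
  rw [Real.norm_of_nonneg (kk_pos _ _ _).le]
  exact kk_le_one ht _ _

lemma KK_pos (μ : Measure (Fin p → ℝ)) [IsProbabilityMeasure μ] {t : ℝ} (ht : 0 < t)
    (y : Fin p → ℝ) : 0 < KK μ t y := by
  unfold KK
  rw [integral_pos_iff_support_of_nonneg (fun x => (kk_pos _ _ _).le) (integrable_kk μ ht y)]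
  have : Function.support (fun x => kk t y x) = Set.univ := by
    ext x; simp [(kk_pos t y x).ne']
  simp [this]

lemma KK_le_one (μ : Measure (Fin p → ℝ)) [IsProbabilityMeasure μ] {t : ℝ} (ht : 0 < t)
    (y : Fin p → ℝ) : KK μ t y ≤ 1 := by
  unfold KK
  calc ∫ x, kk t y x ∂μ ≤ ∫ x, 1 ∂μ :=
        integral_mono (integrable_kk μ ht y) (integrable_const _) (fun x => kk_le_one ht y x)
    _ = 1 := by simp

lemma measurable_KK (μ : Measure (Fin p → ℝ)) [IsProbabilityMeasure μ] (t : ℝ) :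
    Measurable (fun y => KK μ t y) := by
  unfold KK
  have : StronglyMeasurable (fun q : (Fin p → ℝ) × (Fin p → ℝ) => kk t q.1 q.2) := by
    unfold kk
    exact Measurable.stronglyMeasurable (by fun_prop)
  exact this.integral_prod_right'.measurable

lemma measurable_avg (μ : Measure (Fin p → ℝ)) [IsProbabilityMeasure μ] (t : ℝ)
    {φ : (Fin p → ℝ) → ℝ} (hφ : Measurable φ) :
    Measurable (fun y => avg μ t φ y) := by
  unfold avg
  refine Measurable.div ?_ (measurable_KK μ t)
  have : StronglyMeasurable (fun q : (Fin p → ℝ) × (Fin p → ℝ) => φ q.2 * kk t q.1 q.2) := by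
    unfold kk
    exact Measurable.stronglyMeasurable (by fun_prop)
  exact this.integral_prod_right'.measurable

lemma avg_sub (μ : Measure (Fin p → ℝ)) {t : ℝ} (ht : 0 < t)
    {φ ψ : (Fin p → ℝ) → ℝ} (hφ : Integrable φ μ) (hψ : Integrable ψ μ) (y : Fin p → ℝ) :
    avg μ t (fun x => φ x - ψ x) y = avg μ t φ y - avg μ t ψ y := by
  unfold avg
  rw [← sub_div, ← integral_sub (integrable_mul_kk μ ht hφ y) (integrable_mul_kk μ ht hψ y)]
  simp only [sub_mul]

lemma avg_add (μ : Measure (Fin p → ℝ)) {t : ℝ} (ht : 0 < t)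
    {φ ψ : (Fin p → ℝ) → ℝ} (hφ : Integrable φ μ) (hψ : Integrable ψ μ) (y : Fin p → ℝ) :
    avg μ t (fun x => φ x + ψ x) y = avg μ t φ y + avg μ t ψ y := by
  unfold avg
  rw [← add_div, ← integral_add (integrable_mul_kk μ ht hφ y) (integrable_mul_kk μ ht hψ y)]
  simp only [add_mul]

lemma avg_mul_const (μ : Measure (Fin p → ℝ)) (t c : ℝ)
    (φ : (Fin p → ℝ) → ℝ) (y : Fin p → ℝ) :
    avg μ t (fun x => c * φ x) y = c * avg μ t φ y := by
  unfold avg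
  simp only [mul_assoc]
  rw [integral_const_mul, mul_div_assoc]

lemma avg_const (μ : Measure (Fin p → ℝ)) [IsProbabilityMeasure μ] {t : ℝ} (ht : 0 < t) (c : ℝ)
    (y : Fin p → ℝ) :
    avg μ t (fun _ => c) y = c := by
  unfold avg
  rw [integral_const_mul]
  exact mul_div_cancel_right₀ _ (KK_pos μ ht y).ne'

lemma avg_sum (μ : Measure (Fin p → ℝ)) {t : ℝ} (ht : 0 < t)
    {φ : Fin p → (Fin p → ℝ) → ℝ} (hφ : ∀ i, Integrable (φ i) μ) (y : Fin p → ℝ) :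
    avg μ t (fun x => ∑ i, φ i x) y = ∑ i, avg μ t (φ i) y := by
  unfold avg
  simp only [Finset.sum_mul]
  rw [integral_finsetSum _ (fun i _ => integrable_mul_kk μ ht (hφ i) y), Finset.sum_div]

lemma avg_mono (μ : Measure (Fin p → ℝ)) [IsProbabilityMeasure μ] {t : ℝ} (ht : 0 < t)
    {φ ψ : (Fin p → ℝ) → ℝ} (hφ : Integrable φ μ) (hψ : Integrable ψ μ) (h : ∀ x, φ x ≤ ψ x)
    (y : Fin p → ℝ) :
    avg μ t φ y ≤ avg μ t ψ y := by
  unfold avg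
  refine div_le_div_of_nonneg_right ?_ (KK_pos μ ht y).le
  exact integral_mono (integrable_mul_kk μ ht hφ y) (integrable_mul_kk μ ht hψ y)
    (fun x => mul_le_mul_of_nonneg_right (h x) (kk_pos _ _ _).le)

/-- Variance of posterior is nonneg -/
lemma avg_sq_le (μ : Measure (Fin p → ℝ)) [IsProbabilityMeasure μ] {t : ℝ} (ht : 0 < t)
    {φ : (Fin p → ℝ) → ℝ} (hφ : Integrable φ μ) (hφ2 : Integrable (fun x => φ x ^ 2) μ)
    (y : Fin p → ℝ) :
    avg μ t φ y ^ 2 ≤ avg μ t (fun x => φ x ^ 2) y := by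
  set m := avg μ t φ y with hm
  have h := avg_mono μ ht (φ := fun x => 2 * m * φ x - m ^ 2) (ψ := fun x => φ x ^ 2)
    ((hφ.const_mul _).sub (integrable_const _)) hφ2
    (fun x => by nlinarith [sq_nonneg (φ x - m)]) y
  rw [avg_sub μ ht (hφ.const_mul _) (integrable_const _), avg_mul_const, avg_const μ ht, ← hm] at h
  nlinarith

/-- Gibbs variational inequality. -/
lemma log_KK_ge (μ : Measure (Fin p → ℝ)) [IsProbabilityMeasure μ] {a b : ℝ} (ha : 0 < a)
    (hb : 0 < b) (y z : Fin p → ℝ) {D : (Fin p → ℝ) → ℝ} (hD : Integrable D μ)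
    (h : ∀ x, kk b z x = Real.exp (D x) * kk a y x) :
    avg μ a D y ≤ Real.log (KK μ b z) - Real.log (KK μ a y) := by
  set c := avg μ a D y with hc
  have hK := KK_pos μ ha y
  rw [← Real.log_div (KK_pos μ hb z).ne' hK.ne', Real.le_log_iff_exp_le (by
    have := KK_pos μ hb z; positivity), le_div_iff₀ hK]
  have h1 : ∫ x, (Real.exp c * (1 - c)) * kk a y x + Real.exp c * (D x * kk a y x) ∂μ
      ≤ KK μ b z := by
    unfold KK
    refine integral_mono (((integrable_kk μ ha y).const_mul _).add
      ((integrable_mul_kk μ ha hD y).const_mul _)) (integrable_kk μ hb z) ?_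
    intro x
    simp only
    rw [h x]
    have h2 : Real.exp (D x) = Real.exp c * Real.exp (D x - c) := by
      rw [← Real.exp_add]; congr 1; ring
    have h3 := Real.add_one_le_exp (D x - c)
    have h4 := mul_le_mul_of_nonneg_left h3 (mul_pos (Real.exp_pos c) (kk_pos a y x)).le
    rw [h2]
    nlinarith
  rw [integral_add ((integrable_kk μ ha y).const_mul _) ((integrable_mul_kk μ ha hD y).const_mul _),
    integral_const_mul, integral_const_mul] at h1
  have h5 : ∫ x, D x * kk a y x ∂μ = c * KK μ a y := by
    rw [hc, avg, div_mul_cancel₀ _ hK.ne']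
  rw [h5] at h1
  have h6 : ∫ x, kk a y x ∂μ = KK μ a y := rfl
  rw [h6] at h1
  nlinarith

/-- Jensen lower bound. -/
lemma log_KK_ge' (μ : Measure (Fin p → ℝ)) [IsProbabilityMeasure μ] {b : ℝ}
    (hb : 0 < b) (z : Fin p → ℝ) 
    (hD : Integrable (fun x => -(∑ i, (z i - x i) ^ 2) / (2 * b)) μ) :
    ∫ x, (-(∑ i, (z i - x i) ^ 2) / (2 * b)) ∂μ ≤ Real.log (KK μ b z) := by
  rw [Real.le_log_iff_exp_le (KK_pos μ hb z)]
  have := convexOn_exp.map_integral_le (μ := μ) Real.continuous_exp.continuousOn isClosed_univ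
    (f := (fun x => -(∑ i, (z i - x i) ^ 2) / (2 * b))) (by simp) hD (integrable_kk μ hb z)
  exact this

end basics
section law
variable {p : ℕ}

open scoped ENNReal NNReal

lemma pi_gaussian (x : Fin p → ℝ) (v : ℝ≥0) (hv : v ≠ 0) :
    Measure.pi (fun i => gaussianReal (x i) v) =
      (volume : Measure (Fin p → ℝ)).withDensity
        (fun y => ENNReal.ofReal (∏ i, gaussianPDFReal (x i) v (y i))) := by
  symm
  refine (Measure.pi_eq ?_).symm
  intro s hs
  rw [withDensity_apply _ (MeasurableSet.univ_pi hs), volume_pi, Measure.restrict_pi_pi]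
  have h1 : Integrable (fun y : Fin p → ℝ => ∏ i, gaussianPDFReal (x i) v (y i))
      (Measure.pi fun i => (volume : Measure ℝ).restrict (s i)) :=
    Integrable.fintype_prod (fun i => (integrable_gaussianPDFReal _ _).integrableOn)
  rw [← ofReal_integral_eq_lintegral_ofReal h1
    (Eventually.of_forall fun y => Finset.prod_nonneg fun i _ => gaussianPDFReal_nonneg _ _ _),
    integral_fintype_prod_eq_prod,
    ENNReal.ofReal_prod_of_nonneg
      (fun i _ => integral_nonneg fun _ => gaussianPDFReal_nonneg _ _ _)]
  refine Finset.prod_congr rfl fun i _ => ?_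
  rw [gaussianReal_apply_eq_integral _ hv]

lemma map_stdGaussian (x : Fin p → ℝ) {t : ℝ} (ht : 0 < t) :
    (_root_.stdGaussian p).map (fun z => x + Real.sqrt t • z) =
      (volume : Measure (Fin p → ℝ)).withDensity
        (fun y => ENNReal.ofReal ((Real.sqrt (2 * Real.pi * t))⁻¹ ^ p * kk t y x)) := by
  have h0 : (fun z : Fin p → ℝ => x + Real.sqrt t • z) =
      fun z i => x i + Real.sqrt t * z i := by
    ext z i; simp
  have h1 : ∀ i, (gaussianReal 0 1).map (fun z => x i + Real.sqrt t * z)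
      = gaussianReal (x i) t.toNNReal := by
    intro i
    have := Measure.map_map (μ := gaussianReal 0 1) (g := fun z => x i + z)
      (f := fun z => Real.sqrt t * z) (by fun_prop) (by fun_prop)
    rw [gaussianReal_map_const_mul, gaussianReal_map_const_add] at this
    rw [show (fun z => x i + Real.sqrt t * z) = (fun z => x i + z) ∘ (fun z => Real.sqrt t * z)
      from rfl, ← this]
    congr 1
    · simp
    · ext; simp [Real.sq_sqrt ht.le, ht.le]
  rw [h0, _root_.stdGaussian, Measure.pi_map_pi
    (fun i => (show Measurable (fun z => x i + Real.sqrt t * z) by fun_prop).aemeasurable)]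
  simp only [h1]
  rw [pi_gaussian _ _ (by simpa using ht)]
  congr 1
  ext y
  congr 1
  simp only [gaussianPDFReal, kk]
  rw [Finset.prod_mul_distrib, Finset.prod_const, ← Real.exp_sum]
  simp [ht.le, Finset.sum_div, neg_div]

variable {Ω : Type*} [MeasurableSpace Ω] (P : Measure Ω) [IsProbabilityMeasure P]
    (X Z : Ω → Fin p → ℝ)

lemma lintegral_joint (hX : Measurable X) (hZ : Measurable Z)
    (hZlaw : P.map Z = _root_.stdGaussian p) (hindep : IndepFun X Z P) {t : ℝ} (ht : 0 < t)
    {f : (Fin p → ℝ) × (Fin p → ℝ) → ℝ≥0∞} (hf : Measurable f) :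
    ∫⁻ ω, f (X ω, X ω + Real.sqrt t • Z ω) ∂P =
      ∫⁻ x, ∫⁻ y, ENNReal.ofReal ((Real.sqrt (2 * Real.pi * t))⁻¹ ^ p * kk t y x) * f (x, y)
        ∂volume ∂(P.map X) := by
  have hpr := (indepFun_iff_map_prod_eq_prod_map_map hX.aemeasurable hZ.aemeasurable).1 hindep
  have : IsProbabilityMeasure (_root_.stdGaussian p) := by
    unfold _root_.stdGaussian; infer_instance
  have hg : Measurable (fun q : (Fin p → ℝ) × (Fin p → ℝ) => f (q.1, q.1 + Real.sqrt t • q.2)) := by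
    fun_prop
  have e1 : ∫⁻ ω, f (X ω, X ω + Real.sqrt t • Z ω) ∂P =
      ∫⁻ q, f (q.1, q.1 + Real.sqrt t • q.2) ∂(P.map (fun ω => (X ω, Z ω))) := by
    rw [lintegral_map hg (hX.prodMk hZ)]
  rw [e1, hpr, hZlaw, lintegral_prod _ hg.aemeasurable]
  refine lintegral_congr fun x => ?_
  have e2 := lintegral_map (μ := _root_.stdGaussian p) (f := fun y => f (x, y))
    (g := fun z => x + Real.sqrt t • z) (by fun_prop) (by fun_prop)
  rw [← e2, map_stdGaussian x ht, lintegral_withDensity_eq_lintegral_mul]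
  · rfl
  · have := measurable_kk' (p := p) t
    unfold kk
    fun_prop
  · fun_prop

lemma measurable_dens (μ : Measure (Fin p → ℝ)) [IsProbabilityMeasure μ] (t : ℝ) :
    Measurable (fun q : (Fin p → ℝ) × (Fin p → ℝ) => kk t q.2 q.1 / KK μ t q.2) :=
  (measurable_kk t).div ((measurable_KK μ t).comp measurable_snd)

lemma map_joint (hX : Measurable X) (hZ : Measurable Z)
    (hZlaw : P.map Z = _root_.stdGaussian p) (hindep : IndepFun X Z P) {t : ℝ} (ht : 0 < t) :
    P.map (fun ω => (X ω, X ω + Real.sqrt t • Z ω)) =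
      ((P.map X).prod (P.map (fun ω => X ω + Real.sqrt t • Z ω))).withDensity
        (fun q => ENNReal.ofReal (kk t q.2 q.1 / KK (P.map X) t q.2)) := by
  have : IsProbabilityMeasure (P.map X) := Measure.isProbabilityMeasure_map hX.aemeasurable
  have hY : Measurable (fun ω => X ω + Real.sqrt t • Z ω) := by fun_prop
  have : IsProbabilityMeasure (P.map (fun ω => X ω + Real.sqrt t • Z ω)) :=
    Measure.isProbabilityMeasure_map hY.aemeasurable
  set μ := P.map X with hμ
  set C := (Real.sqrt (2 * Real.pi * t))⁻¹ ^ p with hC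
  have hC0 : 0 ≤ C := by positivity
  have hd := (measurable_dens μ t).ennreal_ofReal
  have hkm := (measurable_kk (p := p) t)
  have hν : ∀ g : (Fin p → ℝ) → ℝ≥0∞, Measurable g →
      ∫⁻ y, g y ∂(P.map (fun ω => X ω + Real.sqrt t • Z ω)) =
        ∫⁻ y, ENNReal.ofReal (C * KK μ t y) * g y := by
    intro g hg
    rw [lintegral_map hg hY]
    have := lintegral_joint P X Z hX hZ hZlaw hindep ht (f := fun q => g q.2) (by fun_prop)
    rw [this, lintegral_lintegral_swap]
    · refine lintegral_congr fun y => ?_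
      change ∫⁻ x, ENNReal.ofReal (C * kk t y x) * g y ∂μ = _
      rw [lintegral_mul_const _ ((measurable_kk' t y).const_mul _).ennreal_ofReal]
      congr 1
      rw [← ofReal_integral_eq_lintegral_ofReal ((integrable_kk μ ht y).const_mul _)
        (Eventually.of_forall fun x => mul_nonneg hC0 (kk_pos _ _ _).le), integral_const_mul]
      rfl
    · refine Measurable.aemeasurable ?_
      exact ((hkm.const_mul _).ennreal_ofReal).mul (hg.comp measurable_snd)
  refine Measure.ext fun s hs => ?_
  rw [Measure.map_apply (hX.prodMk hY) hs, withDensity_apply _ hs]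
  rw [← lintegral_indicator hs, lintegral_prod _ ((hd.indicator hs).aemeasurable)]
  have hi : Measurable (s.indicator (1 : (Fin p → ℝ) × (Fin p → ℝ) → ℝ≥0∞)) :=
    measurable_one.indicator hs
  have e1 := lintegral_joint P X Z hX hZ hZlaw hindep ht hi
  have e2 : ∫⁻ ω, s.indicator (1 : (Fin p → ℝ) × (Fin p → ℝ) → ℝ≥0∞)
      (X ω, X ω + Real.sqrt t • Z ω) ∂P
      = P ((fun ω => (X ω, X ω + Real.sqrt t • Z ω)) ⁻¹' s) := by
    rw [← lintegral_indicator_one ((hX.prodMk hY) hs)]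
    rfl
  rw [← e2, e1]
  refine lintegral_congr fun x => ?_
  refine Eq.trans ?_ (hν (fun y => s.indicator (fun x => ENNReal.ofReal
    (kk t x.2 x.1 / KK μ t x.2)) (x, y)) ((hd.indicator hs).comp measurable_prodMk_left)).symm
  refine lintegral_congr fun y => ?_
  by_cases hxy : (x, y) ∈ s
  · simp only [Set.indicator_of_mem hxy, Pi.one_apply, mul_one]
    rw [← ENNReal.ofReal_mul (mul_nonneg hC0 (KK_pos μ ht y).le)]
    congr 1
    have := (KK_pos μ ht y).ne'
    change C * kk t y x = C * KK μ t y * (kk t y x / KK μ t y)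
    field_simp
  · simp [Set.indicator_of_notMem hxy]

end law
section bayes
variable {p : ℕ} {Ω : Type*} [MeasurableSpace Ω] (P : Measure Ω) [IsProbabilityMeasure P]
    (X Z : Ω → Fin p → ℝ)

lemma bayes (hX : Measurable X) (hZ : Measurable Z)
    (hZlaw : P.map Z = _root_.stdGaussian p) (hindep : IndepFun X Z P) {t : ℝ} (ht : 0 < t)
    {φ g : (Fin p → ℝ) → ℝ} (hφ : Measurable φ) (hg : Measurable g)
    (hi : Integrable (fun ω => φ (X ω) * g (X ω + Real.sqrt t • Z ω)) P) :
    Integrable (fun ω => avg (P.map X) t φ (X ω + Real.sqrt t • Z ω) *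
      g (X ω + Real.sqrt t • Z ω)) P ∧
    ∫ ω, avg (P.map X) t φ (X ω + Real.sqrt t • Z ω) * g (X ω + Real.sqrt t • Z ω) ∂P
      = ∫ ω, φ (X ω) * g (X ω + Real.sqrt t • Z ω) ∂P := by
  have : IsProbabilityMeasure (P.map X) := Measure.isProbabilityMeasure_map hX.aemeasurable
  have hY : Measurable (fun ω => X ω + Real.sqrt t • Z ω) := by fun_prop
  have : IsProbabilityMeasure (P.map (fun ω => X ω + Real.sqrt t • Z ω)) :=
    Measure.isProbabilityMeasure_map hY.aemeasurable
  have hj := map_joint P X Z hX hZ hZlaw hindep ht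
  set μ := P.map X with hμ
  set ν := P.map (fun ω => X ω + Real.sqrt t • Z ω) with hν
  have hh : Measurable (fun q : (Fin p → ℝ) × (Fin p → ℝ) => φ q.1 * g q.2) := by fun_prop
  have hd := (measurable_dens μ t)
  have h1 : Integrable (fun q : (Fin p → ℝ) × (Fin p → ℝ) => φ q.1 * g q.2)
      (P.map (fun ω => (X ω, X ω + Real.sqrt t • Z ω))) := by
    rw [integrable_map_measure hh.aestronglyMeasurable (hX.prodMk hY).aemeasurable]
    exact hi
  have e1 : ∫ ω, φ (X ω) * g (X ω + Real.sqrt t • Z ω) ∂P =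
      ∫ q, φ q.1 * g q.2 ∂(P.map (fun ω => (X ω, X ω + Real.sqrt t • Z ω))) := by
    rw [integral_map (hX.prodMk hY).aemeasurable hh.aestronglyMeasurable]
  rw [hj, integrable_withDensity_iff_integrable_smul' hd.ennreal_ofReal
    (Eventually.of_forall fun _ => ENNReal.ofReal_lt_top)] at h1
  rw [hj, integral_withDensity_eq_integral_toReal_smul hd.ennreal_ofReal
    (Eventually.of_forall fun _ => ENNReal.ofReal_lt_top), integral_prod_symm _ h1] at e1
  have h2 := h1.integral_prod_right
  have key : ∀ y, ∫ x, (ENNReal.ofReal (kk t y x / KK μ t y)).toReal • (φ x * g y) ∂μ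
      = avg μ t φ y * g y := by
    intro y
    unfold avg
    rw [div_mul_eq_mul_div, mul_div_assoc, ← integral_mul_const]
    refine integral_congr_ae (Eventually.of_forall fun x => ?_)
    simp only [smul_eq_mul]
    rw [ENNReal.toReal_ofReal (div_nonneg (kk_pos _ _ _).le (KK_pos μ ht y).le)]
    ring
  simp only [key] at h2 e1
  have hm : Measurable (fun y => avg μ t φ y * g y) := (measurable_avg μ t hφ).mul hg
  rw [hν, integrable_map_measure hm.aestronglyMeasurable hY.aemeasurable] at h2
  rw [hν, integral_map hY.aemeasurable hm.aestronglyMeasurable] at e1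
  exact ⟨h2, e1.symm⟩

lemma condExp_eq (hX : Measurable X) (hZ : Measurable Z)
    (hZlaw : P.map Z = _root_.stdGaussian p) (hindep : IndepFun X Z P) {t : ℝ} (ht : 0 < t)
    {φ : (Fin p → ℝ) → ℝ} (hφ : Measurable φ)
    (hi : Integrable (fun ω => φ (X ω)) P) :
    (fun ω => avg (P.map X) t φ (X ω + Real.sqrt t • Z ω)) =ᵐ[P]
    P[fun ω' => φ (X ω') |
            MeasurableSpace.comap (fun ω' => X ω' + Real.sqrt t • Z ω')
              inferInstance] := by
  have : IsProbabilityMeasure (P.map X) := Measure.isProbabilityMeasure_map hX.aemeasurable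
  have hY : Measurable (fun ω => X ω + Real.sqrt t • Z ω) := by fun_prop
  have h0 := (bayes P X Z hX hZ hZlaw hindep ht hφ (g := fun _ => 1) measurable_const
    (by simpa using hi))
  simp only [mul_one] at h0
  refine ae_eq_condExp_of_forall_setIntegral_eq hY.comap_le hi (fun s _ _ => h0.1.integrableOn)
    ?_ ?_
  · rintro s ⟨A, hA, rfl⟩ -
    have hg : Measurable (A.indicator (1 : (Fin p → ℝ) → ℝ)) := measurable_one.indicator hA
    have hm : ∀ f : Ω → ℝ, (fun ω => f ω * A.indicator (1 : (Fin p → ℝ) → ℝ)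
        (X ω + Real.sqrt t • Z ω)) = ((fun ω' => X ω' + Real.sqrt t • Z ω') ⁻¹' A).indicator f := by
      intro f
      ext ω
      by_cases h : X ω + Real.sqrt t • Z ω ∈ A
      · simp [Set.indicator, h]
      · simp [Set.indicator, h]
    have h1 := bayes P X Z hX hZ hZlaw hindep ht hφ hg (by
      rw [hm]; exact hi.indicator (hY hA))
    have := h1.2
    rw [hm, hm, integral_indicator (hY hA), integral_indicator (hY hA)] at this
    exact this
  · exact StronglyMeasurable.aestronglyMeasurable
      ((measurable_avg (P.map X) t hφ).comp (comap_measurable _)).stronglyMeasurable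

end bayes
set_option linter.unusedSectionVars false
section moments
variable {p : ℕ} {Ω : Type*} [MeasurableSpace Ω] (P : Measure Ω) [IsProbabilityMeasure P]
    (X Z : Ω → Fin p → ℝ)

lemma memLp_X (hX : Measurable X) (hXmom : Integrable (fun ω => ∑ i, X ω i ^ 2) P) (i : Fin p) :
    MemLp (fun ω => X ω i) 2 P := by
  have hm : Measurable (fun ω => X ω i) := by fun_prop
  rw [memLp_two_iff_integrable_sq hm.aestronglyMeasurable]
  refine hXmom.mono' (by fun_prop) ?_
  filter_upwards with ω
  rw [Real.norm_of_nonneg (sq_nonneg _)]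
  exact Finset.single_le_sum (f := fun i => X ω i ^ 2) (fun i _ => sq_nonneg _) (Finset.mem_univ i)

lemma memLp_Z (hZ : Measurable Z) (hZlaw : P.map Z = _root_.stdGaussian p) (i : Fin p) :
    MemLp (fun ω => Z ω i) 2 P := by
  have h1 : MemLp (fun z : Fin p → ℝ => z i) 2 (_root_.stdGaussian p) := by
    have h2 : MeasurePreserving (Function.eval i) (_root_.stdGaussian p) (gaussianReal 0 1) :=
      measurePreserving_eval _ i
    exact (memLp_id_gaussianReal (μ := 0) (v := 1) 2).comp_measurePreserving h2
  rw [← hZlaw] at h1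
  exact h1.comp_of_map hZ.aemeasurable

lemma memLp_Y (hX : Measurable X) (hZ : Measurable Z)
    (hXmom : Integrable (fun ω => ∑ i, X ω i ^ 2) P)
    (hZlaw : P.map Z = _root_.stdGaussian p) (t : ℝ) (i : Fin p) :
    MemLp (fun ω => (X ω + Real.sqrt t • Z ω) i) 2 P := by
  have := (memLp_X P X hX hXmom i).add ((memLp_Z P Z hZ hZlaw i).const_mul (Real.sqrt t))
  exact this

lemma integrable_mu (hX : Measurable X) (hXmom : Integrable (fun ω => ∑ i, X ω i ^ 2) P)
    (i : Fin p) : Integrable (fun x : Fin p → ℝ => x i) (P.map X) := by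
  rw [integrable_map_measure (Measurable.aestronglyMeasurable (by fun_prop)) hX.aemeasurable]
  exact (memLp_X P X hX hXmom i).integrable one_le_two

lemma integrable_mu2 (hX : Measurable X) (hXmom : Integrable (fun ω => ∑ i, X ω i ^ 2) P)
    (i : Fin p) : Integrable (fun x : Fin p → ℝ => x i ^ 2) (P.map X) := by
  rw [integrable_map_measure (Measurable.aestronglyMeasurable (by fun_prop)) hX.aemeasurable]
  exact (memLp_X P X hX hXmom i).integrable_sq

/-- All the moment identities. -/
lemma moments (hX : Measurable X) (hZ : Measurable Z)
    (hXmom : Integrable (fun ω => ∑ i, X ω i ^ 2) P)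
    (hZlaw : P.map Z = _root_.stdGaussian p) (hindep : IndepFun X Z P) {t : ℝ} (ht : 0 < t)
    (i : Fin p) (m M : Ω → ℝ)
    (hm : m = fun ω => avg (P.map X) t (fun x => x i) (X ω + Real.sqrt t • Z ω))
    (hM : M = fun ω => avg (P.map X) t (fun x => x i ^ 2) (X ω + Real.sqrt t • Z ω)) :
    MemLp m 2 P ∧ Integrable M P ∧ ∫ ω, M ω ∂P = ∫ ω, X ω i ^ 2 ∂P ∧
    ∫ ω, X ω i * m ω ∂P = ∫ ω, m ω ^ 2 ∂P ∧
    ∫ ω, m ω * Z ω i ∂P - ∫ ω, X ω i * Z ω i ∂P =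
      (∫ ω, X ω i ^ 2 ∂P - ∫ ω, m ω ^ 2 ∂P) / Real.sqrt t := by
  have : IsProbabilityMeasure (P.map X) := Measure.isProbabilityMeasure_map hX.aemeasurable
  have hY : Measurable (fun ω => X ω + Real.sqrt t • Z ω) := by fun_prop
  have hXi := memLp_X P X hX hXmom i
  have hZi := memLp_Z P Z hZ hZlaw i
  have hYi := memLp_Y P X Z hX hZ hXmom hZlaw t i
  have hmm : Measurable (fun y => avg (P.map X) t (fun x => x i) y) :=
    measurable_avg _ t (by fun_prop)
  have b1 := bayes P X Z hX hZ hZlaw hindep ht (φ := fun x => x i ^ 2) (g := fun _ => 1)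
    (by fun_prop) (by fun_prop) (by simpa using hXi.integrable_sq)
  simp only [mul_one] at b1
  rw [← hM] at b1
  have hm2 : MemLp m 2 P := by
    have hmeas : Measurable m := by rw [hm]; exact hmm.comp hY
    rw [memLp_two_iff_integrable_sq hmeas.aestronglyMeasurable]
    refine b1.1.mono' (hmeas.pow_const 2).aestronglyMeasurable ?_
    filter_upwards with ω
    rw [Real.norm_of_nonneg (sq_nonneg _), hm, hM]
    exact avg_sq_le _ ht (integrable_mu P X hX hXmom i) (integrable_mu2 P X hX hXmom i) _
  have b2 := bayes P X Z hX hZ hZlaw hindep ht (φ := fun x => x i)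
    (g := fun y => avg (P.map X) t (fun x => x i) y)
    (by fun_prop) hmm (by
      have := hXi.integrable_mul hm2
      rw [hm] at this
      exact this)
  have b3 := bayes P X Z hX hZ hZlaw hindep ht (φ := fun x => x i)
    (g := fun y => y i)
    (by fun_prop) (by fun_prop) (hXi.integrable_mul hYi)
  have e2 : ∫ ω, X ω i * m ω ∂P = ∫ ω, m ω ^ 2 ∂P := by
    rw [hm]; rw [← b2.2]; simp only [sq]
  refine ⟨hm2, b1.1, b1.2, e2, ?_⟩
  have e3 : ∫ ω, m ω * (X ω i + Real.sqrt t * Z ω i) ∂P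
      = ∫ ω, X ω i * (X ω i + Real.sqrt t * Z ω i) ∂P := by
    rw [hm]; exact b3.2
  have i1 : Integrable (fun ω => X ω i * m ω) P := hXi.integrable_mul hm2
  have i2 : Integrable (fun ω => m ω * Z ω i) P := hm2.integrable_mul hZi
  have i3 : Integrable (fun ω => X ω i * Z ω i) P := hXi.integrable_mul hZi
  have i4 : Integrable (fun ω => X ω i ^ 2) P := hXi.integrable_sq
  have e4 : ∫ ω, m ω * (X ω i + Real.sqrt t * Z ω i) ∂P =
      ∫ ω, X ω i * m ω ∂P + Real.sqrt t * ∫ ω, m ω * Z ω i ∂P := by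
    rw [← integral_const_mul, ← integral_add i1 (i2.const_mul _)]
    congr 1; ext ω; ring
  have e5 : ∫ ω, X ω i * (X ω i + Real.sqrt t * Z ω i) ∂P =
      ∫ ω, X ω i ^ 2 ∂P + Real.sqrt t * ∫ ω, X ω i * Z ω i ∂P := by
    rw [← integral_const_mul, ← integral_add i4 (i3.const_mul _)]
    congr 1; ext ω; ring
  rw [e4, e5, e2] at e3
  have hs : Real.sqrt t ≠ 0 := (Real.sqrt_pos.2 ht).ne'
  rw [eq_div_iff hs]
  linarith

/-- the MMSE -/
noncomputable def mm (t : ℝ) : ℝ :=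
  ∑ i, (∫ ω, X ω i ^ 2 ∂P -
    ∫ ω, avg (P.map X) t (fun x => x i) (X ω + Real.sqrt t • Z ω) ^ 2 ∂P)

lemma mmse_eq (hX : Measurable X) (hZ : Measurable Z)
    (hXmom : Integrable (fun ω => ∑ i, X ω i ^ 2) P)
    (hZlaw : P.map Z = _root_.stdGaussian p) (hindep : IndepFun X Z P) {t : ℝ} (ht : 0 < t) :
    ∫ ω, ∑ i, (X ω i -
          (P[fun ω' => X ω' i |
            MeasurableSpace.comap (fun ω' => X ω' + Real.sqrt t • Z ω')
              inferInstance]) ω) ^ 2 ∂P = mm P X Z t := by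
  have hc : ∀ i, _ := fun i => condExp_eq P X Z hX hZ hZlaw hindep ht (φ := fun x => x i)
    (by fun_prop) ((memLp_X P X hX hXmom i).integrable one_le_two)
  have e1 : ∫ ω, ∑ i, (X ω i -
          (P[fun ω' => X ω' i |
            MeasurableSpace.comap (fun ω' => X ω' + Real.sqrt t • Z ω')
              inferInstance]) ω) ^ 2 ∂P =
      ∫ ω, ∑ i, (X ω i -
        avg (P.map X) t (fun x => x i) (X ω + Real.sqrt t • Z ω)) ^ 2 ∂P := by
    refine integral_congr_ae ?_
    filter_upwards [ae_all_iff.2 hc] with ω hω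
    refine Finset.sum_congr rfl fun i _ => ?_
    rw [← hω i]
  rw [e1, integral_finsetSum]
  · unfold mm
    refine Finset.sum_congr rfl fun i _ => ?_
    obtain ⟨h1, -, -, h4, -⟩ := moments P X Z hX hZ hXmom hZlaw hindep ht i _ _ rfl rfl
    have hXi := memLp_X P X hX hXmom i
    set m := fun ω => avg (P.map X) t (fun x => x i) (X ω + Real.sqrt t • Z ω) with hm
    change ∫ ω, (X ω i - m ω) ^ 2 ∂P = ∫ ω, X ω i ^ 2 ∂P - ∫ ω, m ω ^ 2 ∂P
    have i1 : Integrable (fun ω => X ω i * m ω) P := hXi.integrable_mul h1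
    have : ∀ ω, (X ω i - m ω) ^ 2 = X ω i ^ 2 - 2 * (X ω i * m ω) + m ω ^ 2 := fun ω => by ring
    simp only [this]
    have i2 : Integrable (fun ω => X ω i ^ 2 - 2 * (X ω i * m ω)) P :=
      hXi.integrable_sq.sub (i1.const_mul 2)
    rw [integral_add i2 h1.integrable_sq,
      integral_sub hXi.integrable_sq (i1.const_mul 2), integral_const_mul, h4]
    ring
  · intro i _
    obtain ⟨h1, -, -, h4, -⟩ := moments P X Z hX hZ hXmom hZlaw hindep ht i _ _ rfl rfl
    exact ((memLp_X P X hX hXmom i).sub h1).integrable_sq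

lemma integrable_logK (hX : Measurable X) (hZ : Measurable Z)
    (hXmom : Integrable (fun ω => ∑ i, X ω i ^ 2) P)
    (hZlaw : P.map Z = _root_.stdGaussian p) {t : ℝ} (ht : 0 < t) :
    Integrable (fun ω => Real.log (KK (P.map X) t (X ω + Real.sqrt t • Z ω))) P := by
  have : IsProbabilityMeasure (P.map X) := Measure.isProbabilityMeasure_map hX.aemeasurable
  have hY : Measurable (fun ω => X ω + Real.sqrt t • Z ω) := by fun_prop
  have h1 : ∀ i, _ := fun i => integrable_mu P X hX hXmom i
  have h2 : ∀ i, _ := fun i => integrable_mu2 P X hX hXmom i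
  have hb : Integrable (fun ω => ∑ i, ((X ω + Real.sqrt t • Z ω) i ^ 2 + ∫ x, x i ^ 2 ∂(P.map X)) / t)
      P := by
    refine integrable_finsetSum _ fun i _ => ?_
    exact ((memLp_Y P X Z hX hZ hXmom hZlaw t i).integrable_sq.add (integrable_const _)).div_const _
  refine hb.mono' (((measurable_KK (P.map X) t).comp hY).log).aestronglyMeasurable ?_
  filter_upwards with ω
  set y := X ω + Real.sqrt t • Z ω with hy
  have hle : Real.log (KK (P.map X) t y) ≤ 0 :=
    Real.log_nonpos (KK_pos _ ht y).le (KK_le_one _ ht y)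
  rw [Real.norm_of_nonpos hle]
  have hsq : ∀ i, Integrable (fun x : Fin p → ℝ => (y i - x i) ^ 2) (P.map X) := by
    intro i
    have : (fun x : Fin p → ℝ => (y i - x i) ^ 2) =
        fun x => (y i ^ 2 - 2 * y i * x i) + x i ^ 2 := by ext x; ring
    rw [this]
    exact ((integrable_const _).sub ((h1 i).const_mul _)).add (h2 i)
  have hI : Integrable (fun x : Fin p → ℝ => -(∑ i, (y i - x i) ^ 2) / (2 * t)) (P.map X) :=
    (integrable_finsetSum _ fun i _ => hsq i).neg.div_const _
  have hJ := log_KK_ge' (P.map X) ht y hI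
  have hK : - ∑ i, (y i ^ 2 + ∫ x, x i ^ 2 ∂(P.map X)) / t
      ≤ ∫ x, (-(∑ i, (y i - x i) ^ 2) / (2 * t)) ∂(P.map X) := by
    rw [integral_div, integral_neg, integral_finsetSum _ fun i _ => hsq i, neg_div, neg_le_neg_iff,
      Finset.sum_div]
    refine Finset.sum_le_sum fun i _ => ?_
    have : ∫ x, (y i - x i) ^ 2 ∂(P.map X) ≤ ∫ x, 2 * (y i ^ 2 + x i ^ 2) ∂(P.map X) :=
      integral_mono (hsq i) (((integrable_const _).add (h2 i)).const_mul _)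
        (fun x => by nlinarith [sq_nonneg (y i + x i)])
    rw [integral_const_mul, integral_add (integrable_const _) (h2 i)] at this
    simp only [integral_const, probReal_univ, one_smul] at this
    rw [div_le_div_iff₀ (by positivity) ht]
    nlinarith
  linarith

noncomputable def GG (t : ℝ) : ℝ :=
  ∫ ω, Real.log (KK (P.map X) t (X ω + Real.sqrt t • Z ω)) ∂P

lemma sandwich (hX : Measurable X) (hZ : Measurable Z)
    (hXmom : Integrable (fun ω => ∑ i, X ω i ^ 2) P)
    (hZlaw : P.map Z = _root_.stdGaussian p) (hindep : IndepFun X Z P) {a b : ℝ} (ha : 0 < a)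
    (hb : 0 < b) :
    mm P X Z a * (1 / (Real.sqrt a * Real.sqrt b) - 1 / b) ≤ GG P X Z b - GG P X Z a := by
  have : IsProbabilityMeasure (P.map X) := Measure.isProbabilityMeasure_map hX.aemeasurable
  have hsa := Real.sqrt_pos.2 ha
  have hsb := Real.sqrt_pos.2 hb
  have hqa := Real.sq_sqrt ha.le
  have hqb := Real.sq_sqrt hb.le
  have h1 : ∀ i, _ := fun i => integrable_mu P X hX hXmom i
  have h2 : ∀ i, _ := fun i => integrable_mu2 P X hX hXmom i
  set A := (1 / a - 1 / b) / 2 with hA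
  set B := 1 / Real.sqrt a - 1 / Real.sqrt b with hB
  let m : Fin p → Ω → ℝ := fun i ω => avg (P.map X) a (fun x => x i) (X ω + Real.sqrt a • Z ω)
  let M : Fin p → Ω → ℝ := fun i ω => avg (P.map X) a (fun x => x i ^ 2) (X ω + Real.sqrt a • Z ω)
  have hpt : ∀ ω, ∑ i, (A * (X ω i ^ 2 - 2 * (X ω i * m i ω) + M i ω)
        + B * (X ω i * Z ω i - m i ω * Z ω i))
      ≤ Real.log (KK (P.map X) b (X ω + Real.sqrt b • Z ω)) -
        Real.log (KK (P.map X) a (X ω + Real.sqrt a • Z ω)) := by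
    intro ω
    have j1 : ∀ i, Integrable (fun x : Fin p → ℝ => (A * X ω i ^ 2 + B * (X ω i * Z ω i))
        - (2 * A * X ω i + B * Z ω i) * x i) (P.map X) := fun i =>
      (integrable_const _).sub ((h1 i).const_mul _)
    have j2 : ∀ i, Integrable (fun x : Fin p → ℝ => A * x i ^ 2) (P.map X) := fun i =>
      (h2 i).const_mul _
    have j3 : ∀ i, Integrable (fun x : Fin p → ℝ => ((A * X ω i ^ 2 + B * (X ω i * Z ω i))
        - (2 * A * X ω i + B * Z ω i) * x i) + A * x i ^ 2) (P.map X) := fun i =>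
      (j1 i).add (j2 i)
    have hg := log_KK_ge (P.map X) ha hb (X ω + Real.sqrt a • Z ω) (X ω + Real.sqrt b • Z ω)
      (D := fun x => ∑ i, (((A * X ω i ^ 2 + B * (X ω i * Z ω i))
        - (2 * A * X ω i + B * Z ω i) * x i) + A * x i ^ 2))
      (integrable_finsetSum _ fun i _ => j3 i) (by
        intro x
        unfold kk
        rw [← Real.exp_add]
        congr 1
        rw [← Finset.sum_neg_distrib, ← Finset.sum_neg_distrib, Finset.sum_div, Finset.sum_div,
          ← Finset.sum_add_distrib]
        refine Finset.sum_congr rfl fun i _ => ?_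
        simp only [Pi.add_apply, Pi.smul_apply, smul_eq_mul, hA, hB]
        rw [← hqa, ← hqb]
        simp only [Real.sqrt_sq hsa.le, Real.sqrt_sq hsb.le]
        field_simp
        ring)
    rw [avg_sum _ ha j3] at hg
    refine le_trans (le_of_eq ?_) hg
    refine Finset.sum_congr rfl fun i _ => ?_
    rw [avg_add _ ha (j1 i) (j2 i), avg_sub _ ha (integrable_const _) ((h1 i).const_mul _),
      avg_const _ ha, avg_mul_const, avg_mul_const]
    simp only [m, M]
    ring
  have hmo : ∀ i, _ := fun i =>
    moments P X Z hX hZ hXmom hZlaw hindep ha i (m i) (M i) rfl rfl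
  have i0 : ∀ i, Integrable (fun ω => X ω i ^ 2) P := fun i =>
    (memLp_X P X hX hXmom i).integrable_sq
  have i1 : ∀ i, Integrable (fun ω => X ω i * m i ω) P := fun i =>
    (memLp_X P X hX hXmom i).integrable_mul (hmo i).1
  have i2 : ∀ i, Integrable (fun ω => X ω i * Z ω i) P := fun i =>
    (memLp_X P X hX hXmom i).integrable_mul (memLp_Z P Z hZ hZlaw i)
  have i3 : ∀ i, Integrable (fun ω => m i ω * Z ω i) P := fun i =>
    (hmo i).1.integrable_mul (memLp_Z P Z hZ hZlaw i)
  have i4 : ∀ i, Integrable (fun ω => A * (X ω i ^ 2 - 2 * (X ω i * m i ω) + M i ω)) P := fun i =>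
    (((i0 i).sub ((i1 i).const_mul 2)).add (hmo i).2.1).const_mul A
  have i5 : ∀ i, Integrable (fun ω => B * (X ω i * Z ω i - m i ω * Z ω i)) P := fun i =>
    ((i2 i).sub (i3 i)).const_mul B
  have i6 : ∀ i, Integrable (fun ω => A * (X ω i ^ 2 - 2 * (X ω i * m i ω) + M i ω) +
      B * (X ω i * Z ω i - m i ω * Z ω i)) P := fun i => (i4 i).add (i5 i)
  have i7 : ∀ i, Integrable (fun ω => X ω i ^ 2 - 2 * (X ω i * m i ω)) P := fun i =>
    (i0 i).sub ((i1 i).const_mul 2)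
  have i8 : Integrable (fun ω => Real.log (KK (P.map X) b (X ω + Real.sqrt b • Z ω)) -
        Real.log (KK (P.map X) a (X ω + Real.sqrt a • Z ω))) P :=
    (integrable_logK P X Z hX hZ hXmom hZlaw hb).sub (integrable_logK P X Z hX hZ hXmom hZlaw ha)
  have hintg := integral_mono (integrable_finsetSum _ fun i _ => i6 i) i8 hpt
  rw [integral_sub (integrable_logK P X Z hX hZ hXmom hZlaw hb)
    (integrable_logK P X Z hX hZ hXmom hZlaw ha)] at hintg
  refine le_trans (le_of_eq ?_) hintg
  rw [integral_finsetSum _ fun i _ => i6 i, mm, Finset.sum_mul]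
  refine Finset.sum_congr rfl fun i _ => ?_
  obtain ⟨-, k2, k3, k4, k5⟩ := hmo i
  rw [integral_add (i4 i) (i5 i), integral_const_mul, integral_const_mul,
    integral_add (i7 i) k2, integral_sub (i0 i) ((i1 i).const_mul 2),
    integral_const_mul, integral_sub (i2 i) (i3 i), k3, k4]
  have k6 : ∫ ω, X ω i * Z ω i ∂P - ∫ ω, m i ω * Z ω i ∂P =
      - ((∫ ω, X ω i ^ 2 ∂P - ∫ ω, m i ω ^ 2 ∂P) / Real.sqrt a) := by rw [← k5]; ring
  rw [k6]
  change (∫ ω, X ω i ^ 2 ∂P - ∫ ω, m i ω ^ 2 ∂P) * _ = _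
  generalize (∫ ω, X ω i ^ 2 ∂P) = u
  generalize (∫ ω, m i ω ^ 2 ∂P) = v
  rw [hA, hB, ← hqa, ← hqb]
  simp only [Real.sqrt_sq hsa.le, Real.sqrt_sq hsb.le]
  field_simp
  ring

end moments
section cont

lemma fatou_real {Ω ι : Type*} [MeasurableSpace Ω] {P : Measure Ω} {l : Filter ι}
    [l.IsCountablyGenerated] [l.NeBot] {f : ι → Ω → ℝ} {f0 : Ω → ℝ} (hf : ∀ n, Integrable (f n) P)
    (hf0 : Integrable f0 P) (h : ∀ n ω, 0 ≤ f n ω) (h0 : ∀ ω, 0 ≤ f0 ω)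
    (hlim : ∀ ω, Tendsto (fun n => f n ω) l (𝓝 (f0 ω))) {c : ℝ} (hc : c < ∫ ω, f0 ω ∂P) :
    ∀ᶠ n in l, c < ∫ ω, f n ω ∂P := by
  by_cases hc0 : c < 0
  · exact Eventually.of_forall fun n => hc0.trans_le (integral_nonneg (h n))
  push Not at hc0
  have h1 := lintegral_liminf_le' (μ := P) (u := l) (f := fun n ω => ENNReal.ofReal (f n ω))
    (fun n => (hf n).aemeasurable.ennreal_ofReal)
  have h2 : ∀ ω, liminf (fun n => ENNReal.ofReal (f n ω)) l = ENNReal.ofReal (f0 ω) := fun ω =>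
    (ENNReal.tendsto_ofReal (hlim ω)).liminf_eq
  simp only [h2] at h1
  rw [← ofReal_integral_eq_lintegral_ofReal hf0 (Eventually.of_forall h0)] at h1
  have h3 : ENNReal.ofReal c < ENNReal.ofReal (∫ ω, f0 ω ∂P) :=
    (ENNReal.ofReal_lt_ofReal_iff (hc0.trans_lt hc)).2 hc
  filter_upwards [eventually_lt_of_lt_liminf (h3.trans_le h1)] with n hn
  rw [← ofReal_integral_eq_lintegral_ofReal (hf n) (Eventually.of_forall (h n))] at hn
  exact (ENNReal.ofReal_lt_ofReal_iff_of_nonneg hc0).1 hn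

lemma scheffe_real {Ω ι : Type*} [MeasurableSpace Ω] {P : Measure Ω} {l : Filter ι}
    [l.IsCountablyGenerated] [l.NeBot] {f g : ι → Ω → ℝ} {f0 g0 : Ω → ℝ}
    (hf : ∀ n, Integrable (f n) P)
    (hf0 : Integrable f0 P) (h : ∀ n ω, 0 ≤ f n ω) (h0 : ∀ ω, 0 ≤ f0 ω)
    (hlim : ∀ ω, Tendsto (fun n => f n ω) l (𝓝 (f0 ω)))
    (hg : ∀ n, Integrable (g n) P)
    (hg0 : Integrable g0 P) (h' : ∀ n ω, 0 ≤ g n ω) (h0' : ∀ ω, 0 ≤ g0 ω)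
    (hlim' : ∀ ω, Tendsto (fun n => g n ω) l (𝓝 (g0 ω))) (C : ℝ)
    (hC : ∀ n, ∫ ω, f n ω ∂P + ∫ ω, g n ω ∂P = C) (hC0 : ∫ ω, f0 ω ∂P + ∫ ω, g0 ω ∂P = C) :
    Tendsto (fun n => ∫ ω, f n ω ∂P) l (𝓝 (∫ ω, f0 ω ∂P)) := by
  rw [tendsto_order]
  refine ⟨fun c hc => fatou_real hf hf0 h h0 hlim hc, fun c hc => ?_⟩
  have : C - c < ∫ ω, g0 ω ∂P := by linarith
  filter_upwards [fatou_real hg hg0 h' h0' hlim' this] with n hn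
  have := hC n
  linarith

variable {p : ℕ}

lemma continuousAt_num (μ : Measure (Fin p → ℝ)) {φ : (Fin p → ℝ) → ℝ}
    (hφ : Integrable φ μ) (x0 z0 : Fin p → ℝ) {a : ℝ} (ha : 0 < a) :
    ContinuousAt (fun t => ∫ x, φ x * kk t (x0 + Real.sqrt t • z0) x ∂μ) a := by
  refine continuousAt_of_dominated (bound := fun x => |φ x|) ?_ ?_ hφ.abs ?_
  · filter_upwards with t
    exact hφ.aestronglyMeasurable.mul (measurable_kk' t _).aestronglyMeasurable
  · filter_upwards [Ioi_mem_nhds ha] with t ht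
    filter_upwards with x
    rw [norm_mul, Real.norm_of_nonneg (kk_pos _ _ _).le, Real.norm_eq_abs]
    exact mul_le_of_le_one_right (abs_nonneg _) (kk_le_one ht _ _)
  · filter_upwards with x
    unfold kk
    simp only [Pi.add_apply, Pi.smul_apply, smul_eq_mul]
    have h2 : 2 * a ≠ 0 := by positivity
    refine ContinuousAt.mul continuousAt_const ?_
    refine Real.continuous_exp.continuousAt.comp ?_
    refine ContinuousAt.div ?_ (by fun_prop) h2
    exact Continuous.continuousAt (by fun_prop)

lemma continuousAt_avg (μ : Measure (Fin p → ℝ)) [IsProbabilityMeasure μ] {φ : (Fin p → ℝ) → ℝ}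
    (hφ : Integrable φ μ) (x0 z0 : Fin p → ℝ) {a : ℝ} (ha : 0 < a) :
    ContinuousAt (fun t => avg μ t φ (x0 + Real.sqrt t • z0)) a := by
  unfold avg
  refine (continuousAt_num μ hφ x0 z0 ha).div ?_ (KK_pos μ ha _).ne'
  have := continuousAt_num μ (integrable_const (1 : ℝ)) x0 z0 ha
  simpa only [one_mul, KK] using this

variable {Ω : Type*} [MeasurableSpace Ω] (P : Measure Ω) [IsProbabilityMeasure P]
    (X Z : Ω → Fin p → ℝ)

lemma continuousAt_mm (hX : Measurable X) (hZ : Measurable Z)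
    (hXmom : Integrable (fun ω => ∑ i, X ω i ^ 2) P)
    (hZlaw : P.map Z = _root_.stdGaussian p) (hindep : IndepFun X Z P) {a : ℝ} (ha : 0 < a) :
    ContinuousAt (mm P X Z) a := by
  have : IsProbabilityMeasure (P.map X) := Measure.isProbabilityMeasure_map hX.aemeasurable
  have h1 : ∀ i, _ := fun i => integrable_mu P X hX hXmom i
  have h2 : ∀ i, _ := fun i => integrable_mu2 P X hX hXmom i
  suffices H : ∀ i, ContinuousOn (fun t => ∫ ω, avg (P.map X) t (fun x => x i)
      (X ω + Real.sqrt t • Z ω) ^ 2 ∂P) (Set.Ioi 0) by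
    have : ContinuousOn (mm P X Z) (Set.Ioi 0) := by
      unfold mm
      exact continuousOn_finsetSum _ fun i _ => continuousOn_const.sub (H i)
    exact this.continuousAt (Ioi_mem_nhds ha)
  intro i
  rw [continuousOn_iff_continuous_domRestrict, continuous_iff_continuousAt]
  rintro s
  have hmo : ∀ t : Set.Ioi (0 : ℝ), _ := fun t =>
    moments P X Z hX hZ hXmom hZlaw hindep t.2 i _ _ rfl rfl
  have hcm : ∀ (φ : (Fin p → ℝ) → ℝ), Integrable φ (P.map X) → ∀ ω,
      Tendsto (fun t : Set.Ioi (0 : ℝ) => avg (P.map X) t φ (X ω + Real.sqrt t • Z ω)) (𝓝 s)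
        (𝓝 (avg (P.map X) s φ (X ω + Real.sqrt s • Z ω))) := by
    intro φ hφ ω
    exact (continuousAt_avg (P.map X) hφ (X ω) (Z ω) s.2).tendsto.comp
      continuous_subtype_val.continuousAt
  have hi : ∀ t : Set.Ioi (0 : ℝ), Integrable (fun ω => avg (P.map X) t (fun x => x i ^ 2)
      (X ω + Real.sqrt t • Z ω) - avg (P.map X) t (fun x => x i)
      (X ω + Real.sqrt t • Z ω) ^ 2) P := fun t => (hmo t).2.1.sub (hmo t).1.integrable_sq
  have hnn : ∀ (t : Set.Ioi (0 : ℝ)) ω, 0 ≤ avg (P.map X) t (fun x => x i ^ 2)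
      (X ω + Real.sqrt t • Z ω) - avg (P.map X) t (fun x => x i)
      (X ω + Real.sqrt t • Z ω) ^ 2 := fun t ω =>
    sub_nonneg.2 (avg_sq_le (P.map X) t.2 (h1 i) (h2 i) _)
  have hsum : ∀ t : Set.Ioi (0 : ℝ), ∫ ω, avg (P.map X) t (fun x => x i)
      (X ω + Real.sqrt t • Z ω) ^ 2 ∂P + ∫ ω, (avg (P.map X) t (fun x => x i ^ 2)
      (X ω + Real.sqrt t • Z ω) - avg (P.map X) t (fun x => x i)
      (X ω + Real.sqrt t • Z ω) ^ 2) ∂P = ∫ ω, X ω i ^ 2 ∂P := by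
    intro t
    rw [integral_sub (hmo t).2.1 (hmo t).1.integrable_sq, (hmo t).2.2.1]
    ring
  exact scheffe_real (P := P) (l := 𝓝 s) (fun t => (hmo t).1.integrable_sq)
    (hmo s).1.integrable_sq (fun _ _ => sq_nonneg _) (fun _ => sq_nonneg _)
    (fun ω => (hcm _ (h1 i) ω).pow 2) hi (hi s) hnn (hnn s)
    (fun ω => (hcm _ (h2 i) ω).sub ((hcm _ (h1 i) ω).pow 2)) _ hsum (hsum s)

lemma hasDerivAt_GG (hX : Measurable X) (hZ : Measurable Z)
    (hXmom : Integrable (fun ω => ∑ i, X ω i ^ 2) P)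
    (hZlaw : P.map Z = _root_.stdGaussian p) (hindep : IndepFun X Z P) {a : ℝ} (ha : 0 < a) :
    HasDerivAt (GG P X Z) (mm P X Z a / (2 * a ^ 2)) a := by
  have hsa := Real.sqrt_pos.2 ha
  have hqa := Real.sq_sqrt ha.le
  have hsq : HasDerivAt (fun b => 1 / (Real.sqrt a * Real.sqrt b)) (-1 / (2 * a ^ 2)) a := by
    have h := ((Real.hasDerivAt_sqrt ha.ne').const_mul (Real.sqrt a)).inv (by positivity)
    simp only [one_div]
    refine h.congr_deriv ?_
    have : a ^ 2 = Real.sqrt a ^ 4 := by rw [← hqa]; simp only [Real.sqrt_sq hsa.le]; ring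
    rw [this]
    field_simp
  have hinv : HasDerivAt (fun b : ℝ => 1 / b) (-1 / a ^ 2) a := by
    have h := hasDerivAt_inv ha.ne'
    simp only [one_div]
    refine h.congr_deriv ?_
    ring
  set c := mm P X Z a with hc
  have hl : HasDerivAt (fun b => c * (1 / (Real.sqrt a * Real.sqrt b) - 1 / b))
      (c / (2 * a ^ 2)) a := by
    refine ((hsq.sub hinv).const_mul c).congr_deriv ?_
    field_simp
    ring
  have hss : 1 / (Real.sqrt a * Real.sqrt a) = 1 / a := by rw [← sq, hqa]
  have hu0 : HasDerivAt (fun b => 1 / a - 1 / (Real.sqrt a * Real.sqrt b))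
      (1 / (2 * a ^ 2)) a := by
    refine (hsq.const_sub (1 / a)).congr_deriv ?_
    ring
  have hu : HasDerivAt (fun b => mm P X Z b * (1 / a - 1 / (Real.sqrt a * Real.sqrt b)))
      (c / (2 * a ^ 2)) a := by
    rw [hasDerivAt_iff_tendsto_slope] at hu0 ⊢
    have h1 : Tendsto (mm P X Z) (𝓝[≠] a) (𝓝 c) :=
      (continuousAt_mm P X Z hX hZ hXmom hZlaw hindep ha).tendsto.mono_left nhdsWithin_le_nhds
    have h2 := h1.mul hu0
    rw [mul_one_div] at h2
    refine h2.congr fun b => ?_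
    simp only [slope_def_field, hss]
    ring
  rw [hasDerivAt_iff_isLittleO] at hl hu ⊢
  have hd := hu.sub hl
  have hO : (fun b => GG P X Z b - GG P X Z a - c * (1 / (Real.sqrt a * Real.sqrt b) - 1 / b))
      =o[𝓝 a] fun b => b - a := by
    refine Asymptotics.IsBigO.trans_isLittleO ?_ hd
    refine Asymptotics.IsBigO.of_bound 1 ?_
    filter_upwards [Ioi_mem_nhds ha] with b hb
    have s1 := sandwich P X Z hX hZ hXmom hZlaw hindep ha hb
    have s2 := sandwich P X Z hX hZ hXmom hZlaw hindep hb ha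
    rw [mul_comm (Real.sqrt b)] at s2
    simp only [hss, sub_self, mul_zero, sub_zero, one_mul]
    rw [← hc] at s1
    rw [Real.norm_of_nonneg (by linarith)]
    refine le_trans ?_ (le_abs_self _)
    nlinarith
  have := hO.add hl
  refine this.congr_left fun b => ?_
  simp only [hss, sub_self, mul_zero, sub_zero]
  ring

lemma mutualInfo_eq (hX : Measurable X) (hZ : Measurable Z)
    (hXmom : Integrable (fun ω => ∑ i, X ω i ^ 2) P)
    (hZlaw : P.map Z = _root_.stdGaussian p) (hindep : IndepFun X Z P) {t : ℝ} (ht : 0 < t) :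
    (mutualInfo P X (fun ω => X ω + Real.sqrt t • Z ω)).toReal =
      ∫ ω, (-(∑ i, Z ω i ^ 2) / 2) ∂P - GG P X Z t := by
  have : IsProbabilityMeasure (P.map X) := Measure.isProbabilityMeasure_map hX.aemeasurable
  have hY : Measurable (fun ω => X ω + Real.sqrt t • Z ω) := by fun_prop
  have : IsProbabilityMeasure (P.map (fun ω => X ω + Real.sqrt t • Z ω)) :=
    Measure.isProbabilityMeasure_map hY.aemeasurable
  have hj := map_joint P X Z hX hZ hZlaw hindep ht
  set μ := P.map X with hμ
  set ν := P.map (fun ω => X ω + Real.sqrt t • Z ω) with hν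
  set J := P.map (fun ω => (X ω, X ω + Real.sqrt t • Z ω)) with hJ
  have hac : J ≪ μ.prod ν := by rw [hj]; exact withDensity_absolutelyContinuous _ _
  have hd := measurable_dens μ t
  have hrn : (fun q => Real.log ((J.rnDeriv (μ.prod ν) q).toReal)) =ᵐ[J]
      fun q => Real.log (kk t q.2 q.1 / KK μ t q.2) := by
    have h := Measure.rnDeriv_withDensity (μ.prod ν) hd.ennreal_ofReal
    rw [← hj] at h
    filter_upwards [hac.ae_le h] with q hq
    rw [hq, ENNReal.toReal_ofReal (div_nonneg (kk_pos _ _ _).le (KK_pos μ ht _).le)]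
  have hpt : ∀ ω, Real.log (kk t (X ω + Real.sqrt t • Z ω) (X ω) / KK μ t (X ω + Real.sqrt t • Z ω))
      = -(∑ i, Z ω i ^ 2) / 2 - Real.log (KK μ t (X ω + Real.sqrt t • Z ω)) := by
    intro ω
    rw [Real.log_div (kk_pos _ _ _).ne' (KK_pos μ ht _).ne', kk, Real.log_exp]
    congr 1
    simp only [Pi.add_apply, Pi.smul_apply, smul_eq_mul, add_sub_cancel_left, mul_pow,
      Real.sq_sqrt ht.le]
    rw [← Finset.mul_sum]
    field_simp
  have hmeas : Measurable (fun q : (Fin p → ℝ) × (Fin p → ℝ) =>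
      Real.log (kk t q.2 q.1 / KK μ t q.2)) := hd.log
  have iZ : Integrable (fun ω => -(∑ i, Z ω i ^ 2) / 2) P :=
    (integrable_finsetSum _ fun i _ => (memLp_Z P Z hZ hZlaw i).integrable_sq).neg.div_const _
  have iK := integrable_logK P X Z hX hZ hXmom hZlaw ht
  have hintg : Integrable (fun q => Real.log ((J.rnDeriv (μ.prod ν) q).toReal)) J := by
    rw [integrable_congr hrn, hJ, integrable_map_measure hmeas.aestronglyMeasurable
      (hX.prodMk hY).aemeasurable]
    have : ((fun q : (Fin p → ℝ) × (Fin p → ℝ) => Real.log (kk t q.2 q.1 / KK μ t q.2)) ∘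
        fun ω => (X ω, X ω + Real.sqrt t • Z ω)) = fun ω =>
        -(∑ i, Z ω i ^ 2) / 2 - Real.log (KK μ t (X ω + Real.sqrt t • Z ω)) := by
      ext ω; exact hpt ω
    rw [this]
    exact iZ.sub iK
  have hval : ∫ q, Real.log ((J.rnDeriv (μ.prod ν) q).toReal) ∂J =
      ∫ ω, (-(∑ i, Z ω i ^ 2) / 2) ∂P - GG P X Z t := by
    rw [integral_congr_ae hrn, hJ, integral_map (hX.prodMk hY).aemeasurable
      hmeas.aestronglyMeasurable]
    simp only [hpt]
    rw [integral_sub iZ iK]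
    rfl
  unfold mutualInfo klDiv
  rw [if_pos ⟨hac, hintg⟩, EReal.toReal_coe]
  exact hval

end cont

end IMMSE

/-- I-MMSE relation. For a random vector `X` in `ℝ^p` with
`E‖X‖² < ∞` and an independent standard Gaussian `Z`, setting
`P_IT(t) = I(X; X + √t Z)` and `P_ET(t) = E‖X - E[X | X + √t Z]‖²`, for every
`t > 0` the function `P_IT` is differentiable at `t` and
`P_ET(t) = -2t² P_IT'(t)`. -/
theorem stmt17 {Ω : Type*} [MeasurableSpace Ω] (P : Measure Ω) [IsProbabilityMeasure P]
    (p : ℕ) (X Z : Ω → Fin p → ℝ) (hX : Measurable X) (hZ : Measurable Z)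
    (hXmom : Integrable (fun ω => ∑ i, X ω i ^ 2) P)
    (hZlaw : P.map Z = stdGaussian p) (hindep : IndepFun X Z P) :
    ∀ t : ℝ, 0 < t →
      DifferentiableAt ℝ
        (fun u : ℝ =>
          (mutualInfo P X (fun ω => X ω + Real.sqrt u • Z ω)).toReal) t ∧
      ∫ ω, ∑ i, (X ω i -
          (P[fun ω' => X ω' i |
            MeasurableSpace.comap (fun ω' => X ω' + Real.sqrt t • Z ω')
              inferInstance]) ω) ^ 2 ∂P
        = -(2 * t ^ 2) * deriv
            (fun u : ℝ =>
              (mutualInfo P X (fun ω => X ω + Real.sqrt u • Z ω)).toReal) t := by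
  intro t ht
  have h1 := IMMSE.hasDerivAt_GG P X Z hX hZ hXmom hZlaw hindep ht
  have h2 : HasDerivAt (fun u : ℝ =>
      (mutualInfo P X (fun ω => X ω + Real.sqrt u • Z ω)).toReal)
      (-(IMMSE.mm P X Z t / (2 * t ^ 2))) t := by
    refine (h1.const_sub (∫ ω, (-(∑ i, Z ω i ^ 2) / 2) ∂P)).congr_of_eventuallyEq ?_
    filter_upwards [Ioi_mem_nhds ht] with u hu
    exact IMMSE.mutualInfo_eq P X Z hX hZ hXmom hZlaw hindep hu
  refine ⟨h2.differentiableAt, ?_⟩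
  rw [h2.deriv, IMMSE.mmse_eq P X Z hX hZ hXmom hZlaw hindep ht]
  field_simp
end
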